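/- arXiv:2501.13600 — 2 statements merged into one kernel-verified Lean document; each statement's English description precedes it below -/
import Mathlib

section
/- Every residually finite hyperbolic group admits globally stable cylinders; that is, if G is a hyperbolic group that is residually finite, then G has a Cayley graph X such that the pair (G,X) admits a G-invariant, globally (k,R)-stable choice of θ-cylinders for some constants k, R, θ. -/
/-!
Common definitions: coarse geometry (hyperbolicity, rough geodesics, stable cylinders,
quasi-isometries, quasitrees, coarse medians), word metrics, spaces with walls,
dualisable systems and their dual spaces, walls of quasitrees coming from balls,
and the induced wall structures on images of spaces in products of quasitrees.
-/

open Set Metric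

namespace GSC

universe u v w

variable {X Y : Type*}

/-- The Gromov product `⟨y,z⟩_w` with respect to the distance function `d`. -/
noncomputable def gp (d : X → X → ℝ) (w y z : X) : ℝ := (d w y + d w z - d y z) / 2

/-- `d` satisfies the four-point `δ`-hyperbolicity condition. -/
def IsHyp (d : X → X → ℝ) (δ : ℝ) : Prop :=
  ∀ w x y z : X, min (gp d w x y) (gp d w y z) - δ ≤ gp d w x z

/-- `γ`, restricted to `[a,b]`, is a `k`-rough geodesic from `x` to `y`:
a `(1,k)`-quasi-isometric embedding of an interval joining `x` to `y`. -/
def IsRG (d : X → X → ℝ) (k : ℝ) (x y : X) (γ : ℝ → X) (a b : ℝ) : Prop :=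
  a ≤ b ∧ γ a = x ∧ γ b = y ∧
    ∀ s ∈ Icc a b, ∀ t ∈ Icc a b, abs (d (γ s) (γ t) - |s - t|) ≤ k

/-- `X` is `k`-roughly geodesic: any two points are joined by a `k`-rough geodesic. -/
def RGSpace (d : X → X → ℝ) (k : ℝ) : Prop :=
  ∀ x y : X, ∃ γ a b, IsRG d k x y γ a b

/-- The (closed) ball of radius `r` about `x` for the distance function `d`. -/
def rball (d : X → X → ℝ) (x : X) (r : ℝ) : Set X := {p | d x p ≤ r}

/-- `C` is a choice of `θ`-cylinders (with respect to `δ`-rough geodesics): for all `x,y`,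
every `δ`-rough geodesic from `x` to `y` is contained in `C x y`, and `C x y` is contained
in the `θ`-neighbourhood of every `δ`-rough geodesic from `x` to `y`. -/
def IsCylinders (d : X → X → ℝ) (δ θ : ℝ) (C : X → X → Set X) : Prop :=
  ∀ x y γ a b, IsRG d δ x y γ a b →
    γ '' Icc a b ⊆ C x y ∧ ∀ p ∈ C x y, ∃ q ∈ γ '' Icc a b, d p q ≤ θ

/-- The choice of cylinders `C` is globally `(k,R)`-stable: it is reversible, and for any
`x,y,z` the cylinders `C x y` and `C x z` agree inside the ball of radius `⟨y,z⟩ₓ` about `x`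
after removing `k` balls of radius `R`. -/
def IsStable (d : X → X → ℝ) (k : ℕ) (R : ℝ) (C : X → X → Set X) : Prop :=
  (∀ x y, C x y = C y x) ∧
    ∀ x y z : X, ∃ B : Fin k → X,
      (C x y ∩ rball d x (gp d x y z)) \ (⋃ i, rball d (B i) R) =
      (C x z ∩ rball d x (gp d x y z)) \ (⋃ i, rball d (B i) R)

/-- `μ` is a coarse median (coarse centre of triangles) for the hyperbolic distance `d`:
the distance of `μ x y z` to each vertex agrees with the corresponding Gromov product up
to the additive error `c`. -/
def IsCoarseMedian (d : X → X → ℝ) (μ : X → X → X → X) (c : ℝ) : Prop :=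
  ∀ x y z : X,
    |d x (μ x y z) - gp d x y z| ≤ c ∧
    |d y (μ x y z) - gp d y x z| ≤ c ∧
    |d z (μ x y z) - gp d z x y| ≤ c

/-- `f` is a `lam`-quasi-isometric embedding from `(X,dX)` to `(Y,dY)`. -/
def IsQIE (dX : X → X → ℝ) (dY : Y → Y → ℝ) (f : X → Y) (lam : ℝ) : Prop :=
  ∀ x x' : X, dX x x' / lam - lam ≤ dY (f x) (f x') ∧ dY (f x) (f x') ≤ lam * dX x x' + lam

/-- `f` is a `lam`-quasi-isometry from `(X,dX)` to `(Y,dY)`. -/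
def IsQI (dX : X → X → ℝ) (dY : Y → Y → ℝ) (f : X → Y) (lam : ℝ) : Prop :=
  IsQIE dX dY f lam ∧ ∀ y : Y, ∃ x : X, dY (f x) y ≤ lam

/-- `(T,d)` is a quasitree (with constant `lam`): it is roughly geodesic and
quasi-isometric to a simplicial tree. -/
def IsQuasitree {T : Type u} (d : T → T → ℝ) (lam : ℝ) : Prop :=
  RGSpace d lam ∧
    ∃ (V : Type u) (Γ : SimpleGraph V), Γ.IsTree ∧
      ∃ f : T → V, IsQIE d (fun a b => (Γ.dist a b : ℝ)) f lam ∧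
        ∀ v : V, ∃ t : T, (Γ.dist v (f t) : ℝ) ≤ lam

/-- The `ℓ¹` distance on a finite product. -/
noncomputable def l1distF {m : ℕ} {T : Fin m → Type*} (dT : ∀ i, T i → T i → ℝ)
    (p q : ∀ i, T i) : ℝ := ∑ i, dT i (p i) (q i)

/-- The word metric on a group `G` with respect to a generating set `A`
(the distance function of the Cayley graph of `(G,A)`). -/
noncomputable def wordDist {G : Type*} [Group G] (A : Set G) (g h : G) : ℝ :=
  (sInf {n : ℕ | ∃ l : List G, l.length = n ∧ (∀ a ∈ l, a ∈ A ∨ a⁻¹ ∈ A) ∧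
    l.prod = g⁻¹ * h} : ℕ)

/-- `(X, dX, μX)`, with the `G`-action `ρ`, admits a `G`-equivariant quasimedian
quasi-isometric embedding into a product of `m` quasitrees (with the `ℓ¹` metric and
coordinatewise coarse median); i.e. the strong quasitree rank of `(X,G)` is at most `m`. -/
def HasStrongQT {G : Type*} [Group G] {X : Type u} (ρ : G →* Equiv.Perm X)
    (dX : X → X → ℝ) (μX : X → X → X → X) (m : ℕ) : Prop :=
  ∃ (T : Fin m → Type u) (dT : ∀ i, T i → T i → ℝ) (μT : ∀ i, T i → T i → T i → T i)
    (f : X → ∀ i, T i) (α : G →* Equiv.Perm (∀ i, T i)) (lam c : ℝ),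
      (∀ i, IsQuasitree (dT i) lam) ∧
      (∀ i, IsCoarseMedian (dT i) (μT i) c) ∧
      IsQIE dX (l1distF dT) f lam ∧
      (∀ x y z : X, l1distF dT (fun i => μT i (f x i) (f y i) (f z i)) (f (μX x y z)) ≤ c) ∧
      (∀ (g : G) p q, l1distF dT (α g p) (α g q) = l1distF dT p q) ∧
      (∀ (g : G) x, f (ρ g x) = α g (f x))

/-! ### Sets with walls, ultrafilters and dualisable systems

A wall on a set `X` is a bipartition into two halfspaces.  We model a collection of
walls as a collection `H` of halfspaces (subsets of `X`) that is closed under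
complementation; the wall corresponding to a halfspace `h` is the bipartition `{h, hᶜ}`. -/

/-- `H` is a collection of halfspaces closed under complementation (a set of walls). -/
def WallClosed (H : Set (Set X)) : Prop := ∀ h ∈ H, hᶜ ∈ H

/-- `x` is an ultrafilter on the walls `H`: a consistent choice of one halfspace of every
wall of `H`. -/
def IsUF (H : Set (Set X)) (x : Set (Set X)) : Prop :=
  x ⊆ H ∧ (∀ h ∈ H, (h ∈ x ↔ hᶜ ∉ x)) ∧ ∀ h ∈ x, ∀ k ∈ H, h ⊆ k → k ∈ x

/-- The principal ultrafilter of a point `s`: the halfspaces containing `s`. -/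
def pUF (H : Set (Set X)) (s : X) : Set (Set X) := {h ∈ H | s ∈ h}

/-- The set `c` of walls separates the ultrafilters `x` and `y`: they orient every
wall of `c` oppositely. -/
def Seps (x y c : Set (Set X)) : Prop := ∀ h ∈ c, (h ∈ x ↔ h ∉ y)

/-- `d_D(x,y) = sup { |c| : c ∈ D separates x from y }`. -/
noncomputable def dD (D : Set (Set (Set X))) (x y : Set (Set X)) : ℕ∞ :=
  ⨆ (c : Set (Set X)) (_ : c ∈ D ∧ Seps x y c), c.encard

/-- The real-valued version of `dD` (equal to it whenever `dD` is finite). -/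
noncomputable def dDr (D : Set (Set (Set X))) (x y : Set (Set X)) : ℝ :=
  ((dD D x y).toNat : ℝ)

/-- `D` is a dualisable system on the set with walls `(X,H)`. -/
def IsDualisable (H : Set (Set X)) (D : Set (Set (Set X))) : Prop :=
  (∀ c ∈ D, c ⊆ H) ∧ (∀ h ∈ H, ({h} : Set (Set X)) ∈ D) ∧
    (∀ c ∈ D, ∀ c' ⊆ c, c' ∈ D) ∧
    ∀ s t : X, dD D (pUF H s) (pUF H t) < ⊤

/-- The dual space `X_D`: all ultrafilters at finite `d_D`-distance from the principal
ultrafilters of points of `X`. -/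
def dualSpace (H : Set (Set X)) (D : Set (Set (Set X))) : Set (Set (Set X)) :=
  {x | IsUF H x ∧ ∀ s : X, dD D x (pUF H s) < ⊤}

/-- `c` is a chain of walls: the walls of `c` can be oriented so that the chosen
halfspaces are totally ordered by strict inclusion (equivalently, each wall separates
its neighbours). -/
def IsChain' (c : Set (Set X)) : Prop :=
  ∃ σ : Set X → Set X, (∀ h ∈ c, σ h = h ∨ σ h = hᶜ) ∧
    ∀ h ∈ c, ∀ k ∈ c, h ≠ k → σ h ⊂ σ k ∨ σ k ⊂ σ h

/-- The walls of `h` and `k` cross: all four quarterspaces are nonempty. -/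
def Crosses (h k : Set X) : Prop :=
  (h ∩ k).Nonempty ∧ (h ∩ kᶜ).Nonempty ∧ (hᶜ ∩ k).Nonempty ∧ (hᶜ ∩ kᶜ).Nonempty

/-- `c₁ ∪ c₂` is a chain in which all of `c₁` precedes all of `c₂`
(i.e. `c₁ ⊆ c₂⁻`). -/
def ChainPrec (c₁ c₂ : Set (Set X)) : Prop :=
  ∃ σ : Set X → Set X, (∀ h ∈ c₁ ∪ c₂, σ h = h ∨ σ h = hᶜ) ∧
    (∀ h ∈ c₁ ∪ c₂, ∀ k ∈ c₁ ∪ c₂, h ≠ k → σ h ⊂ σ k ∨ σ k ⊂ σ h) ∧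
    ∀ h ∈ c₁, ∀ k ∈ c₂, σ h ⊆ σ k

/-- `D` is `m`-gluable. -/
def Gluable (D : Set (Set (Set X))) (m : ℕ) : Prop :=
  ∀ c₁ ∈ D, ∀ c₂ ∈ D, ChainPrec c₁ c₂ →
    ∃ e ⊆ c₁ ∪ c₂, e.encard ≤ (m : ℕ∞) ∧ (c₁ ∪ c₂) \ e ∈ D

/-- `D` is `L`-separated. -/
def Separated (D : Set (Set (Set X))) (L : ℕ) : Prop :=
  ∀ h₁ h₂ : Set X, ({h₁, h₂} : Set (Set X)) ∈ D → h₁ ≠ h₂ →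
    ∀ c ∈ D, (∀ k ∈ c, Crosses k h₁ ∧ Crosses k h₂) → c.encard ≤ (L : ℕ∞)

/-- The median of three ultrafilters, given by majority vote on each wall. -/
def medUF (x y z : Set (Set X)) : Set (Set X) := x ∩ y ∪ x ∩ z ∪ y ∩ z

/-- The halfspace `h` (with `x` on the `h`-side) separates `x` from the set `A` of
ultrafilters. -/
def SepsFromSet (x : Set (Set X)) (A : Set (Set (Set X))) (h : Set X) : Prop :=
  h ∈ x ∧ ∀ a ∈ A, h ∉ a

/-- The gate map to `A`: `gateMap A x` is obtained from `x` by reversing exactly the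
walls separating `x` from `A`. -/
def gateMap (A : Set (Set (Set X))) (x : Set (Set X)) : Set (Set X) :=
  {h | (h ∈ x ∧ ¬ SepsFromSet x A h) ∨ (h ∉ x ∧ SepsFromSet x A hᶜ)}

/-- `A` is a gated subset of the dual space: it is nonempty and is the intersection of
the dual space with a collection of halfspaces. -/
def IsGated (H : Set (Set X)) (D : Set (Set (Set X))) (A : Set (Set (Set X))) : Prop :=
  A.Nonempty ∧ ∃ H' ⊆ H, A = {x ∈ dualSpace H D | H' ⊆ x}

/-- The halfspace `h`, regarded as a subset of the dual space. -/
def halfSet (H : Set (Set X)) (D : Set (Set (Set X))) (h : Set X) : Set (Set (Set X)) :=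
  {x ∈ dualSpace H D | h ∈ x}

/-! ### Walls of a quasitree coming from balls -/

variable (T : Type*) [MetricSpace T]

/-- `h` is (a halfspace of) one of the two walls of `T` determined by a connected
component `Ct` of the complement of the `K`-ball centred at `t`, namely the bipartitions
`(Ct, T ∖ Ct)` and `(Ct ∪ B, T ∖ (Ct ∪ B))`. -/
def wallFromBall (K : ℝ) (t : T) (h : Set T) : Prop :=
  ∃ Ct : Set T, (∃ p ∈ (closedBall t K)ᶜ, Ct = connectedComponentIn (closedBall t K)ᶜ p) ∧
    (h = Ct ∨ h = Ctᶜ ∨ h = Ct ∪ closedBall t K ∨ h = (Ct ∪ closedBall t K)ᶜ)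

/-- The walls of `T` determined by complementary components of `K`-balls. -/
def ballWalls (K : ℝ) : Set (Set T) := {h | ∃ t : T, wallFromBall T K t h}

/-- Disparate chains of ball-walls: chains of walls admitting defining `K`-balls whose
centres are pairwise at distance at least `10K`. -/
def disparateChains (K : ℝ) : Set (Set (Set T)) :=
  {c | IsChain' c ∧ ∃ β : Set T → T, (∀ h ∈ c, wallFromBall T K (β h) h) ∧
    ∀ h ∈ c, ∀ k ∈ c, h ≠ k → 10 * K ≤ dist (β h) (β k)}

/-! ### The image of a space in a product of dual quasitrees, and its walls -/

variable {m : ℕ}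

/-- The image `S` of `X` in the product `∏ T_{D_i}` of the dual quasitrees: tuples of
principal ultrafilters of the coordinates of points `f x`. -/
def SProd (T : Fin m → Type v) [∀ i, MetricSpace (T i)] (K : Fin m → ℝ)
    (f : X → ∀ i, T i) : Type _ :=
  {p : ∀ i, Set (Set (T i)) // ∃ x : X, p = fun i => pUF (ballWalls (T i) (K i)) (f x i)}

/-- The natural map `X → S`. -/
def sEmb (T : Fin m → Type v) [∀ i, MetricSpace (T i)] (K : Fin m → ℝ)
    (f : X → ∀ i, T i) (x : X) : SProd T K f :=
  ⟨fun i => pUF (ballWalls (T i) (K i)) (f x i), ⟨x, rfl⟩⟩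

/-- The `ℓ¹` metric on `S ⊆ ∏ T_{D_i}`. -/
noncomputable def dS (T : Fin m → Type v) [∀ i, MetricSpace (T i)] (K : Fin m → ℝ)
    (f : X → ∀ i, T i) (p q : SProd T K f) : ℝ :=
  ∑ i, dDr (disparateChains (T i) (K i)) (p.1 i) (q.1 i)

/-- The halfspace of `S` induced by the halfspace `h` of the `i`-th factor. -/
def indHalf (T : Fin m → Type v) [∀ i, MetricSpace (T i)] (K : Fin m → ℝ)
    (f : X → ∀ i, T i) (i : Fin m) (h : Set (T i)) : Set (SProd T K f) :=
  {s | h ∈ s.1 i}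

/-- The walls `W` on `S` induced by the ball-walls of the factors; two such walls cross
exactly when `S` meets all four quarterspaces. -/
def indWalls (T : Fin m → Type v) [∀ i, MetricSpace (T i)] (K : Fin m → ℝ)
    (f : X → ∀ i, T i) : Set (Set (SProd T K f)) :=
  {A | ∃ (i : Fin m) (h : Set (T i)), h ∈ ballWalls (T i) (K i) ∧
    (A = indHalf T K f i h ∨ A = (indHalf T K f i h)ᶜ)}

/-- The monochromatic collections of walls of `S` of colour `i`: images of disparate
chains of the `i`-th factor. -/
def indMono (T : Fin m → Type v) [∀ i, MetricSpace (T i)] (K : Fin m → ℝ)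
    (f : X → ∀ i, T i) (i : Fin m) : Set (Set (Set (SProd T K f))) :=
  {d | ∃ c ∈ disparateChains (T i) (K i), d = (indHalf T K f i) '' c}

/-- `D¹`: unions, over the factors, of (induced) disparate chains. -/
def bigD1 (T : Fin m → Type v) [∀ i, MetricSpace (T i)] (K : Fin m → ℝ)
    (f : X → ∀ i, T i) : Set (Set (Set (SProd T K f))) :=
  {d | ∃ e : ∀ _ : Fin m, Set (Set (SProd T K f)),
    (∀ i, e i ∈ indMono T K f i) ∧ d = ⋃ i, e i}

/-- `D`: the elements of `D¹` that are chains. -/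
def bigD (T : Fin m → Type v) [∀ i, MetricSpace (T i)] (K : Fin m → ℝ)
    (f : X → ∀ i, T i) : Set (Set (Set (SProd T K f))) :=
  {d ∈ bigD1 T K f | IsChain' d}

/-- `d` is an `L`-chain with respect to the system `D`: any member of `D` all of whose
elements cross two given elements of `d` has cardinality at most `L`. -/
def LChainIn {Z : Type*} (D : Set (Set (Set Z))) (L : ℕ) (d : Set (Set Z)) : Prop :=
  ∀ h ∈ d, ∀ k ∈ d, ∀ d' ∈ D, (∀ w ∈ d', Crosses w h ∧ Crosses w k) →
    d'.encard ≤ (L : ℕ∞)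

/-- `C`: the `L`-chains of `D`. -/
def bigC (T : Fin m → Type v) [∀ i, MetricSpace (T i)] (K : Fin m → ℝ)
    (f : X → ∀ i, T i) (L : ℕ) : Set (Set (Set (SProd T K f))) :=
  {d ∈ bigD T K f | LChainIn (bigD T K f) L d}

/-! ### Intervals, distant walls and gates in the dual space `S_C` -/

variable {Z : Type*}

/-- `H(x,y)`: the walls not separating `x` from `y`, oriented (i.e. represented by the
halfspace) so that both `x` and `y` choose them. -/
def Hxy (W : Set (Set Z)) (x y : Set (Set Z)) : Set (Set Z) := {h ∈ W | h ∈ x ∧ h ∈ y}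

/-- The interval `[x,y] = ∩_{h ∈ H(x,y)} h⁺` in the dual space. -/
def interval (W : Set (Set Z)) (D : Set (Set (Set Z))) (x y : Set (Set Z)) :
    Set (Set (Set Z)) :=
  {z ∈ dualSpace W D | Hxy W x y ⊆ z}

/-- `H^L(x,y)`: the distant walls, i.e. the walls of `H(x,y)` such that every
monochromatic chain of `Cc` separating `x` from `y` and crossing them has length at
most `L`. -/
def distantWalls (W : Set (Set Z)) (Cc : Set (Set (Set Z))) (Mono : Set (Set Z) → Prop)
    (L : ℕ) (x y : Set (Set Z)) : Set (Set Z) :=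
  {h ∈ Hxy W x y | ∀ c ∈ Cc, Mono c → Seps x y c → (∀ w ∈ c, Crosses w h) →
    c.encard ≤ (L : ℕ∞)}

/-- `I(x,y) = ∩_{h ∈ H^L(x,y)} h⁺`. -/
def Ixy (W : Set (Set Z)) (Cc : Set (Set (Set Z))) (Mono : Set (Set Z) → Prop)
    (L : ℕ) (x y : Set (Set Z)) : Set (Set (Set Z)) :=
  {z ∈ dualSpace W Cc | distantWalls W Cc Mono L x y ⊆ z}

/-- The halfspace `h⁻`, regarded as a subset of the dual space (the ultrafilters not
choosing `h`). -/
def negSide (W : Set (Set Z)) (D : Set (Set (Set Z))) (h : Set Z) : Set (Set (Set Z)) :=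
  {x ∈ dualSpace W D | h ∉ x}

/-- `H^L_t(x,y)`: the distant walls whose gate to `[x,y]` lies in the ball of radius `t`
about `x`. -/
def HLt (W : Set (Set Z)) (Cc : Set (Set (Set Z))) (Mono : Set (Set Z) → Prop)
    (L : ℕ) (x y : Set (Set Z)) (t : ℝ) : Set (Set Z) :=
  {h ∈ distantWalls W Cc Mono L x y |
    ∀ u ∈ gateMap (interval W Cc x y) '' negSide W Cc h, dDr Cc x u ≤ t}


section Abstract

variable {X : Type*}

/-- `x` and `x'` are both `t`-blocked from `p` by a common point of `S`. -/
def BlkRel (d : X → X → ℝ) (S : Set X) (t : ℝ) (p x x' : X) : Prop :=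
  ∃ y ∈ S, y ≠ p ∧ gp d y x p ≤ t ∧ gp d y x' p ≤ t

/-- The cylinders. -/
def Cyl (d : X → X → ℝ) (S : X → Set X) (t₀ t₃ : ℝ) (x y : X) : Set X :=
  {p | ∃ x' y', Relation.ReflTransGen (BlkRel d (S p) t₀ p) x x' ∧
    Relation.ReflTransGen (BlkRel d (S p) t₀ p) y y' ∧ gp d p x' y' ≤ t₃}

theorem BlkRel.symm' {d : X → X → ℝ} {S : Set X} {t : ℝ} {p x x' : X}
    (h : BlkRel d S t p x x') : BlkRel d S t p x' x := by
  obtain ⟨y, hy, hp, h1, h2⟩ := h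
  exact ⟨y, hy, hp, h2, h1⟩

theorem gp_comm' {d : X → X → ℝ} (hs : ∀ x y, d x y = d y x) (w x y : X) :
    gp d w x y = gp d w y x := by
  unfold gp; rw [hs x y]; ring

theorem gp_add' {d : X → X → ℝ} (hs : ∀ x y, d x y = d y x) (x p q : X) :
    gp d q x p + gp d p x q = d p q := by
  unfold gp; rw [hs q x, hs p x, hs q p]; ring

theorem gp_min {d : X → X → ℝ} {δ : ℝ} (hyp : IsHyp d δ) {w x z : X} {t : ℝ} (y : X)
    (h : gp d w x z ≤ t) (h2 : t + δ < gp d w x y) : gp d w y z ≤ t + δ := by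
  have := hyp w x y z
  by_contra hc
  have : t + δ < min (gp d w x y) (gp d w y z) := lt_min h2 (not_le.1 hc)
  linarith

/-- Key merging step. -/
theorem merge_step {d : X → X → ℝ} {δ N t₀ : ℝ} (hs : ∀ x y, d x y = d y x)
    (hyp : IsHyp d δ) (hδ : 0 ≤ δ) (ht : 0 ≤ t₀) (hN : 2 * (t₀ + 10 * δ) < N)
    {p a b x : X} (hab : N ≤ d a b) (hle : d a p ≤ d b p)
    (h1 : gp d a x p ≤ t₀) (h2 : gp d b x p ≤ t₀ + 2 * δ)
    {x' : X} (h3 : gp d b x' p ≤ t₀ + 2 * δ) : gp d a x' p ≤ t₀ + 2 * δ := by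
  have e0 : N / 2 ≤ gp d b p a := by
    unfold gp; rw [hs b a, hs p a]; linarith
  have f : ∀ u, gp d b u p ≤ t₀ + 2 * δ → N - (t₀ + 2 * δ) - δ ≤ gp d a u b := by
    intro u hu
    have := gp_min hyp a ((gp_comm' hs b p u).trans_le hu) (by linarith)
    have e := gp_add' hs u a b
    rw [gp_comm' hs b a u] at this
    linarith
  have e1 := f x h2
  have e2 := f x' h3
  have e3 := gp_min hyp b h1 (by linarith)
  have e4 := gp_min hyp x' e3 (by rw [gp_comm' hs]; linarith)
  linarith

theorem chain_lemma {d : X → X → ℝ} {δ N t₀ : ℝ} (hs : ∀ x y, d x y = d y x)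
    (hyp : IsHyp d δ) (hδ : 0 ≤ δ) (ht : 0 ≤ t₀) (hN : 2 * (t₀ + 10 * δ) < N)
    {S : Set X} (hsep : ∀ p ∈ S, ∀ q ∈ S, p ≠ q → N ≤ d p q) (p : X)
    (x y : ℕ → X) (n : ℕ) : ∀ a : ℕ,
    (∀ i, a ≤ i → i ≤ a + n → y i ∈ S ∧ gp d (y i) (x i) p ≤ t₀ ∧ gp d (y i) (x (i+1)) p ≤ t₀) →
    ∃ j, a ≤ j ∧ j ≤ a + n ∧ ∀ i, a ≤ i → i ≤ a + n + 1 → gp d (y j) (x i) p ≤ t₀ + 2 * δ := by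
  induction n using Nat.strong_induction_on with
  | _ n ih =>
  intro a H
  obtain ⟨j, hj, hmin⟩ := Finset.exists_min_image (Finset.Icc a (a + n)) (fun i => d (y i) p)
    ⟨a, by simp⟩
  rw [Finset.mem_Icc] at hj
  refine ⟨j, hj.1, hj.2, ?_⟩
  obtain ⟨hjS, hj1, hj2⟩ := H j hj.1 hj.2
  intro i hi1 hi2
  rcases Nat.lt_trichotomy i j with h | h | h
  · -- left part: blockers `a .. j-1`
    obtain ⟨l, hl1, hl2, hl⟩ := ih (j - 1 - a) (by omega) a (fun i h1 h2 => H i h1 (by omega))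
    by_cases hne : y j = y l
    · rw [hne]; exact hl i hi1 (by omega)
    · exact merge_step hs hyp hδ ht hN (hsep _ hjS _ (H l hl1 (by omega)).1 hne)
        (hmin l (by rw [Finset.mem_Icc]; omega)) hj1 (hl j (by omega) (by omega))
        (hl i hi1 (by omega))
  · subst h; linarith
  · by_cases hi : i = j + 1
    · subst hi; linarith
    obtain ⟨l, hl1, hl2, hl⟩ := ih (a + n - (j + 1)) (by omega) (j + 1)
      (fun i h1 h2 => H i (by omega) (by omega))
    by_cases hne : y j = y l
    · rw [hne]; exact hl i (by omega) (by omega)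
    · exact merge_step hs hyp hδ ht hN (hsep _ hjS _ (H l (by omega) (by omega)).1 hne)
        (hmin l (by rw [Finset.mem_Icc]; omega)) hj2 (hl (j+1) (by omega) (by omega))
        (hl i (by omega) (by omega))

theorem chain_of_rtg {d : X → X → ℝ} {S : Set X} {t : ℝ} {p u v : X}
    (h : Relation.ReflTransGen (BlkRel d S t p) u v) : u = v ∨ ∃ (n : ℕ) (x y : ℕ → X),
      x 0 = u ∧ x (n+1) = v ∧ ∀ i, i ≤ n → y i ≠ p ∧
        (y i ∈ S ∧ gp d (y i) (x i) p ≤ t ∧ gp d (y i) (x (i+1)) p ≤ t) := by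
  induction h with
  | refl => left; rfl
  | @tail b c hb hbc ih =>
    right
    obtain ⟨w, hw, hwp, h1, h2⟩ := hbc
    rcases ih with rfl | ⟨n, x, y, hx0, hxn, H⟩
    · refine ⟨0, fun i => if i = 0 then u else c, fun _ => w, by simp, by simp, ?_⟩
      intro i hi
      have : i = 0 := by omega
      subst this
      simpa using ⟨hwp, hw, h1, h2⟩
    · refine ⟨n + 1, fun i => if i ≤ n + 1 then x i else c, fun i => if i ≤ n then y i else w,
        by simp [hx0], by simp, ?_⟩
      intro i hi
      by_cases hin : i ≤ n
      · have := H i hin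
        simpa [hin, show i ≤ n + 1 by omega] using this
      · have : i = n + 1 := by omega
        subst this
        simpa [hxn] using ⟨hwp, hw, h1, h2⟩

theorem coarse_dir {d : X → X → ℝ} {δ N t₀ : ℝ} (hs : ∀ x y, d x y = d y x)
    (hyp : IsHyp d δ) (hδ : 0 ≤ δ) (ht : 0 ≤ t₀) (hN : 2 * (t₀ + 10 * δ) < N)
    {S : Set X} (hsep : ∀ p ∈ S, ∀ q ∈ S, p ≠ q → N ≤ d p q) {p : X} (hp : p ∈ S) {u v : X}
    (h : Relation.ReflTransGen (BlkRel d S t₀ p) u v) :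
    u = v ∨ N - t₀ - 3 * δ ≤ gp d p u v := by
  rcases chain_of_rtg h with h | ⟨n, x, y, hx0, hxn, H⟩
  · exact Or.inl h
  right
  obtain ⟨j, _, hj, hall⟩ := chain_lemma hs hyp hδ ht hN hsep p x y n 0
    (fun i _ hi => (H i (by omega)).2)
  have e1 := hall 0 le_rfl (by omega)
  have e2 := hall (n+1) (by omega) (by omega)
  rw [hx0] at e1
  rw [hxn] at e2
  obtain ⟨hne, hyS, -⟩ := H j (by omega)
  have hd := hsep p hp (y j) hyS hne.symm
  have f1 := gp_add' hs u p (y j)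
  have f2 := gp_add' hs v p (y j)
  have f3 := hyp p u (y j) v
  rw [gp_comm' hs p (y j) v] at f3
  have : N - t₀ - 2 * δ ≤ min (gp d p u (y j)) (gp d p v (y j)) := by
    apply le_min <;> linarith
  linarith

theorem cyl_coarse {d : X → X → ℝ} {δ N t₀ t₃ : ℝ} (hs : ∀ x y, d x y = d y x)
    (hyp : IsHyp d δ) (hδ : 0 ≤ δ) (ht : 0 ≤ t₀) (ht' : t₃ ≤ t₀) (hN : 2 * (t₀ + 10 * δ) < N)
    {S : X → Set X} (hsep : ∀ r, ∀ p ∈ S r, ∀ q ∈ S r, p ≠ q → N ≤ d p q) (hS : ∀ p, p ∈ S p)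
    {x y p : X} (h : p ∈ Cyl d S t₀ t₃ x y) : gp d p x y ≤ t₃ + 2 * δ := by
  obtain ⟨x', y', hx, hy, hg⟩ := h
  have e1 : gp d p x y' ≤ t₃ + δ := by
    rcases coarse_dir hs hyp hδ ht hN (hsep p) (hS p) hx with rfl | h
    · linarith
    · exact gp_min hyp x hg (by rw [gp_comm' hs]; linarith)
  rcases coarse_dir hs hyp hδ ht hN (hsep p) (hS p) hy with rfl | h
  · linarith
  · rw [gp_comm' hs] at e1 ⊢
    have := gp_min hyp y e1 (by rw [gp_comm' hs]; linarith)
    linarith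

theorem cyl_congr {d : X → X → ℝ} {S : X → Set X} {t₀ t₃ : ℝ} {x y z p : X}
    (h : BlkRel d (S p) t₀ p y z) : p ∈ Cyl d S t₀ t₃ x y ↔ p ∈ Cyl d S t₀ t₃ x z := by
  constructor
  · rintro ⟨x', y', hx, hy, hg⟩
    exact ⟨x', y', hx, Relation.ReflTransGen.head h.symm' hy, hg⟩
  · rintro ⟨x', y', hx, hy, hg⟩
    exact ⟨x', y', hx, Relation.ReflTransGen.head h hy, hg⟩

theorem cyl_symm {d : X → X → ℝ} (hs : ∀ x y, d x y = d y x) {S : X → Set X} {t₀ t₃ : ℝ}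
    (x y : X) : Cyl d S t₀ t₃ x y = Cyl d S t₀ t₃ y x := by
  have : ∀ x y, Cyl d S t₀ t₃ x y ⊆ Cyl d S t₀ t₃ y x := by
    rintro x y p ⟨x', y', hx, hy, hg⟩
    exact ⟨y', x', hy, hx, by rwa [gp_comm' hs]⟩
  exact (this x y).antisymm (this y x)

theorem gp_transfer {d : X → X → ℝ} {δ t : ℝ} (hs : ∀ x y, d x y = d y x)
    (hyp : IsHyp d δ) (ht : 0 ≤ t) {x y z p : X}
    (hb : d x p ≤ gp d x y z) (h : gp d p x y ≤ t) : gp d p x z ≤ t + δ := by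
  have e1 := gp_add' hs y x p
  have e2 := gp_add' hs z x p
  rw [gp_comm' hs p y x] at e1
  rw [gp_comm' hs p z x] at e2
  have e3 := hyp x p y z
  rw [gp_comm' hs x p y, gp_comm' hs x p z] at e3
  have : d x p - t ≤ min (gp d x y p) (gp d x y z) := le_min (by linarith) (by linarith)
  linarith

/-- At most one exceptional point for each colour. -/
theorem exceptional_unique {d : X → X → ℝ} {δ N t₀ t₃ : ℝ} (hs : ∀ x y, d x y = d y x)
    (hyp : IsHyp d δ) (hδ : 0 ≤ δ) (ht3 : 0 ≤ t₃) (ht' : t₃ + 4 * δ ≤ t₀)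
    (hN : 2 * (t₀ + 10 * δ) < N)
    {S : X → Set X} (hsep : ∀ r, ∀ p ∈ S r, ∀ q ∈ S r, p ≠ q → N ≤ d p q) (hS : ∀ p, p ∈ S p)
    {x y z p q : X} (hpq : q ∈ S p) (hqp : q ≠ p)
    (hq : q ∈ Cyl d S t₀ t₃ x y ∨ q ∈ Cyl d S t₀ t₃ x z)
    (hqb : d x q ≤ gp d x y z) (hle : d x p ≤ d x q) :
    p ∈ Cyl d S t₀ t₃ x y ↔ p ∈ Cyl d S t₀ t₃ x z := by
  apply cyl_congr
  have key : gp d q x y ≤ t₃ + 3 * δ ∧ gp d q x z ≤ t₃ + 3 * δ := by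
    rcases hq with hq | hq
    · have := cyl_coarse hs hyp hδ (by linarith) (by linarith) hN hsep hS hq
      have := gp_transfer hs hyp (by linarith) hqb this
      constructor <;> linarith
    · have := cyl_coarse hs hyp hδ (by linarith) (by linarith) hN hsep hS hq
      have := gp_transfer hs hyp (by linarith) (by rwa [gp_comm' hs] at hqb) this
      constructor <;> linarith
  have hd := hsep p p (hS p) q hpq hqp.symm
  have e : N / 2 ≤ gp d q x p := by
    unfold gp; rw [hs q x, hs q p]; linarith
  refine ⟨q, hpq, hqp, ?_, ?_⟩
  · have := gp_min hyp p key.1 (by linarith)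
    rw [gp_comm' hs]; linarith
  · have := gp_min hyp p key.2 (by linarith)
    rw [gp_comm' hs]; linarith

theorem cyl_isCylinders {d : X → X → ℝ} {δ N t₀ : ℝ} (hs : ∀ x y, d x y = d y x)
    (hself : ∀ x, d x x = 0) (htri : ∀ x y z, d x z ≤ d x y + d y z)
    (hyp : IsHyp d δ) (hδ : 0 ≤ δ) (ht' : 2 * δ ≤ t₀)
    (hN : 2 * (t₀ + 10 * δ) < N)
    {S : X → Set X} (hsep : ∀ r, ∀ p ∈ S r, ∀ q ∈ S r, p ≠ q → N ≤ d p q) (hS : ∀ p, p ∈ S p) :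
    IsCylinders d δ (20 * δ) (Cyl d S t₀ (2 * δ)) := by
  rintro x y γ a b ⟨hab, rfl, rfl, H⟩
  constructor
  · rintro _ ⟨s, hs', rfl⟩
    refine ⟨_, _, .refl, .refl, ?_⟩
    have e1 := abs_le.1 (H s hs' a ⟨le_rfl, hab⟩)
    have e2 := abs_le.1 (H s hs' b ⟨hab, le_rfl⟩)
    have e3 := abs_le.1 (H a ⟨le_rfl, hab⟩ b ⟨hab, le_rfl⟩)
    rw [abs_of_nonneg (by linarith [hs'.1])] at e1
    rw [abs_of_nonpos (by linarith [hs'.2])] at e2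
    rw [abs_of_nonpos (by linarith)] at e3
    unfold gp
    linarith [e1.2, e2.2, e3.1]
  · intro p hp
    have hg := cyl_coarse hs hyp hδ (by linarith) ht' hN hsep hS hp
    have e3 := abs_le.1 (H a ⟨le_rfl, hab⟩ b ⟨hab, le_rfl⟩)
    rw [abs_of_nonpos (by linarith)] at e3
    have u0 : 0 ≤ gp d (γ a) p (γ b) := by
      unfold gp; rw [hs p (γ b)]
      have := htri (γ a) p (γ b)
      have := htri p (γ a) (γ b)
      rw [hs p (γ a), hs p (γ b)] at this
      linarith
    have u1 : gp d (γ a) p (γ b) ≤ d (γ a) (γ b) := by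
      unfold gp
      have := htri (γ a) (γ b) p
      rw [hs (γ b) p] at this
      linarith
    set u := gp d (γ a) p (γ b) with hu
    have hgu : gp d p (γ a) (γ b) + u = d p (γ a) := by
      rw [hu]; unfold gp; rw [hs (γ a) p]; ring
    obtain ⟨s, hs', hs1, hs2⟩ : ∃ s ∈ Icc a b, s - a ≤ u ∧ u - δ ≤ s - a := by
      refine ⟨min (a + u) b, ⟨le_min (by linarith) hab, min_le_right _ _⟩, ?_, ?_⟩
      · linarith [min_le_left (a + u) b]
      · have : a + u - δ ≤ min (a + u) b := le_min (by linarith) (by linarith [e3.2])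
        linarith
    refine ⟨γ s, ⟨s, hs', rfl⟩, ?_⟩
    have e1 := abs_le.1 (H a ⟨le_rfl, hab⟩ s hs')
    have e2 := abs_le.1 (H s hs' b ⟨hab, le_rfl⟩)
    rw [abs_of_nonpos (by linarith [hs'.1])] at e1
    rw [abs_of_nonpos (by linarith [hs'.2])] at e2
    have f1 : u - 3 * δ ≤ gp d (γ a) (γ b) (γ s) := by
      unfold gp; rw [hs (γ b) (γ s)]; linarith [e1.1, e2.2, e3.1]
    have f2 := hyp (γ a) p (γ b) (γ s)
    have f3 : u - 3 * δ ≤ min (gp d (γ a) p (γ b)) (gp d (γ a) (γ b) (γ s)) :=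
      le_min (by linarith) f1
    have f4 : u - 4 * δ ≤ gp d (γ a) p (γ s) := by linarith
    have f5 : d p (γ s) = d p (γ a) + d (γ a) (γ s) - 2 * gp d (γ a) p (γ s) := by
      unfold gp; rw [hs (γ a) p]; ring
    linarith [e1.2]

end Abstract

section WordMetric

variable {G : Type*} [Group G]

/-- Words of length `n` representing `g`. -/
def WordSet (A : Set G) (g : G) : Set ℕ :=
  {n : ℕ | ∃ l : List G, l.length = n ∧ (∀ a ∈ l, a ∈ A ∨ a⁻¹ ∈ A) ∧ l.prod = g}

theorem wordDist_eq (A : Set G) (g h : G) : wordDist A g h = (sInf (WordSet A (g⁻¹ * h)) : ℕ) := rfl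

theorem wordSet_nonempty {A : Set G} (hA : Subgroup.closure A = ⊤) (g : G) :
    (WordSet A g).Nonempty := by
  have : g ∈ Subgroup.closure A := by rw [hA]; trivial
  rw [← Subgroup.mem_toSubmonoid, Subgroup.closure_toSubmonoid] at this
  obtain ⟨l, hl, hp⟩ := Submonoid.exists_list_of_mem_closure this
  exact ⟨l.length, l, rfl, fun a ha => by simpa using hl a ha, hp⟩

theorem wordDist_word {A : Set G} (hA : Subgroup.closure A = ⊤) (g h : G) :
    ∃ l : List G, (l.length : ℝ) = wordDist A g h ∧ (∀ a ∈ l, a ∈ A ∨ a⁻¹ ∈ A) ∧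
      l.prod = g⁻¹ * h := by
  obtain ⟨l, h1, h2, h3⟩ := Nat.sInf_mem (wordSet_nonempty hA (g⁻¹ * h))
  exact ⟨l, by rw [wordDist_eq, h1], h2, h3⟩

theorem wordDist_le {A : Set G} {g h : G} (l : List G) (h2 : ∀ a ∈ l, a ∈ A ∨ a⁻¹ ∈ A)
    (h3 : l.prod = g⁻¹ * h) : wordDist A g h ≤ l.length := by
  rw [wordDist_eq]
  have : l.length ∈ WordSet A (g⁻¹ * h) := ⟨l, rfl, h2, h3⟩
  exact_mod_cast Nat.sInf_le this

theorem wordDist_self (A : Set G) (g : G) : wordDist A g g = 0 := by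
  have h1 := wordDist_le (A := A) (g := g) (h := g) [] (by simp) (by simp)
  have h2 : 0 ≤ wordDist A g g := by rw [wordDist_eq]; positivity
  simp at h1
  linarith

theorem wordDist_symm {A : Set G} (hA : Subgroup.closure A = ⊤) (g h : G) :
    wordDist A g h = wordDist A h g := by
  have : ∀ g h, wordDist A g h ≤ wordDist A h g := by
    intro g h
    obtain ⟨l, h1, h2, h3⟩ := wordDist_word hA h g
    have := wordDist_le (A := A) (g := g) (h := h) (l.map (·⁻¹)).reverse
      (by
        intro a ha
        simp only [List.mem_reverse, List.mem_map] at ha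
        obtain ⟨b, hb, rfl⟩ := ha
        rw [inv_inv]
        exact (h2 b hb).symm)
      (by rw [← List.prod_inv_reverse, h3]; group)
    simp at this
    linarith
  exact le_antisymm (this g h) (this h g)

theorem wordDist_tri {A : Set G} (hA : Subgroup.closure A = ⊤) (g h k : G) :
    wordDist A g k ≤ wordDist A g h + wordDist A h k := by
  obtain ⟨l, h1, h2, h3⟩ := wordDist_word hA g h
  obtain ⟨l', h1', h2', h3'⟩ := wordDist_word hA h k
  have := wordDist_le (A := A) (g := g) (h := k) (l ++ l')
    (by
      intro a ha
      rcases List.mem_append.1 ha with ha | ha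
      · exact h2 a ha
      · exact h2' a ha)
    (by rw [List.prod_append, h3, h3']; group)
  simp at this
  linarith

theorem wordDist_left (A : Set G) (g x y : G) :
    wordDist A (g * x) (g * y) = wordDist A x y := by
  rw [wordDist_eq, wordDist_eq]
  congr 3
  group

theorem wordDist_ball_finite (A : Finset G) (hA : Subgroup.closure (A : Set G) = ⊤) (N : ℝ) :
    {g : G | wordDist (A : Set G) 1 g < N}.Finite := by
  classical
  let B : Set G := {a | a ∈ A ∨ a⁻¹ ∈ A}
  have hB : B.Finite := by
    have : B = (A : Set G) ∪ (A : Set G)⁻¹ := by ext; simp [B]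
    rw [this]
    exact A.finite_toSet.union A.finite_toSet.inv
  have : Finite B := hB
  have hF := (List.finite_length_le B ⌈N⌉₊).image (fun l : List B => (l.map Subtype.val).prod)
  refine hF.subset ?_
  intro g hg
  obtain ⟨l, h1, h2, h3⟩ := wordDist_word hA 1 g
  refine ⟨l.attach.map (fun a => ⟨a.1, h2 a.1 a.2⟩), ?_, ?_⟩
  · simp only [Set.mem_ofPred_eq, List.length_map, List.length_attach]
    have : (l.length : ℝ) ≤ ⌈N⌉₊ := by
      rw [h1]; exact (le_of_lt hg).trans (Nat.le_ceil N)
    exact_mod_cast this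
  · simp [List.map_map, Function.comp_def] at *
    exact h3

theorem exists_separating (hrf : ∀ g : G, g ≠ 1 → ∃ H : Subgroup G, H.Normal ∧ H.FiniteIndex ∧ g ∉ H)
    {F : Set G} (hF : F.Finite) :
    ∃ H : Subgroup G, H.FiniteIndex ∧ ∀ g ∈ F, g ∈ H → g = 1 := by
  induction F, hF using Set.Finite.induction_on with
  | empty => exact ⟨⊤, inferInstance, by simp⟩
  | @insert a s ha hs ih =>
    obtain ⟨H, h1, h2⟩ := ih
    by_cases h : a = 1
    · refine ⟨H, h1, ?_⟩
      rintro g (rfl | hg) hgH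
      · exact h
      · exact h2 g hg hgH
    · obtain ⟨K, -, hK, haK⟩ := hrf a h
      refine ⟨H ⊓ K, inferInstance, ?_⟩
      rintro g (rfl | hg) hgH
      · exact absurd hgH.2 haK
      · exact h2 g hg hgH.1

theorem blkRel_left {A : Set G} {S : G → Set G} (hSg : ∀ g p q, q ∈ S p → g * q ∈ S (g * p))
    {t : ℝ} {p x x' : G} (g : G)
    (h : BlkRel (wordDist A) (S p) t p x x') :
    BlkRel (wordDist A) (S (g * p)) t (g * p) (g * x) (g * x') := by
  obtain ⟨y, h1, h2, h3, h4⟩ := h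
  refine ⟨g * y, hSg _ _ _ h1, by simpa using h2, ?_, ?_⟩
  · simpa only [gp, wordDist_left] using h3
  · simpa only [gp, wordDist_left] using h4

theorem cyl_left {A : Set G} {S : G → Set G} (hSg : ∀ g p q, q ∈ S p → g * q ∈ S (g * p))
    {t₀ t₃ : ℝ} (g x y : G) :
    Cyl (wordDist A) S t₀ t₃ (g * x) (g * y) = (g * ·) '' Cyl (wordDist A) S t₀ t₃ x y := by
  have key : ∀ g x y p, p ∈ Cyl (wordDist A) S t₀ t₃ x y →
      g * p ∈ Cyl (wordDist A) S t₀ t₃ (g * x) (g * y) := by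
    rintro g x y p ⟨x', y', hx, hy, hg⟩
    refine ⟨g * x', g * y', hx.lift (g * ·) fun _ _ h => blkRel_left hSg g h,
      hy.lift (g * ·) fun _ _ h => blkRel_left hSg g h, ?_⟩
    simpa only [gp, wordDist_left] using hg
  ext p
  constructor
  · intro hp
    refine ⟨g⁻¹ * p, ?_, by simp⟩
    simpa using key g⁻¹ _ _ _ hp
  · rintro ⟨q, hq, rfl⟩
    exact key g x y q hq

end WordMetric

/-- Theorem 1.1 / Theorem 6.2.  Every residually finite hyperbolic
group admits globally stable cylinders: if `G` has a Cayley graph (for a finite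
generating set) that is roughly geodesic and hyperbolic, and `G` is residually finite,
then `G` has a Cayley graph `X` such that the pair `(G,X)` admits a `G`-invariant,
globally `(k,R)`-stable choice of `θ`-cylinders for some constants `k,R,θ`. -/
theorem rf_hyperbolic_admits_globally_stable_cylinders {G : Type u} [Group G]
    (hhyp : ∃ (A : Finset G) (δ : ℝ), Subgroup.closure (A : Set G) = ⊤ ∧ 0 ≤ δ ∧
      IsHyp (wordDist (A : Set G)) δ ∧ RGSpace (wordDist (A : Set G)) δ)
    (hrf : ∀ g : G, g ≠ 1 → ∃ H : Subgroup G, H.Normal ∧ H.FiniteIndex ∧ g ∉ H) :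
    ∃ (A : Finset G) (δ θ R : ℝ) (k : ℕ) (C : G → G → Set G),
      Subgroup.closure (A : Set G) = ⊤ ∧ 0 ≤ δ ∧
      IsHyp (wordDist (A : Set G)) δ ∧ RGSpace (wordDist (A : Set G)) δ ∧
      0 ≤ θ ∧
      IsCylinders (wordDist (A : Set G)) δ θ C ∧
      IsStable (wordDist (A : Set G)) k R C ∧
      ∀ g x y : G, C (g * x) (g * y) = (g * ·) '' C x y := by
  obtain ⟨A, δ, hA, hδ, hyp, hrg⟩ := hhyp
  have hs := wordDist_symm hA
  obtain ⟨H, hH, hHF⟩ := exists_separating hrf (wordDist_ball_finite A hA (100 * δ + 1))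
  let S : G → Set G := fun p => {q | p⁻¹ * q ∈ H}
  have hS : ∀ p, p ∈ S p := fun p => by simp [S, H.one_mem]
  have hSg : ∀ g p q, q ∈ S p → g * q ∈ S (g * p) := by
    intro g p q h
    simpa [S, mul_assoc] using h
  have hsep : ∀ r, ∀ p ∈ S r, ∀ q ∈ S r, p ≠ q →
      100 * δ + 1 ≤ wordDist (A : Set G) p q := by
    intro r p hp q hq hne
    by_contra hc
    apply hne
    have hm : p⁻¹ * q ∈ H := by
      have := H.mul_mem (H.inv_mem hp) hq
      simpa [mul_assoc] using this
    have hb : wordDist (A : Set G) 1 (p⁻¹ * q) < 100 * δ + 1 := by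
      have := wordDist_left (A : Set G) p⁻¹ p q
      rw [inv_mul_cancel] at this
      rw [this]; exact not_le.1 hc
    have := hHF _ hb hm
    exact (inv_mul_eq_one.1 this)
  have hfin : Finite (G ⧸ H) := inferInstance
  refine ⟨A, δ, 20 * δ, 0, Nat.card (G ⧸ H), Cyl (wordDist (A : Set G)) S (6 * δ) (2 * δ), hA, hδ,
    hyp, hrg, by linarith, ?_, ⟨cyl_symm hs, ?_⟩, cyl_left hSg⟩
  · exact cyl_isCylinders hs (wordDist_self _) (wordDist_tri hA) hyp hδ (by linarith)
      (N := 100 * δ + 1) (by linarith) hsep hS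
  · intro x y z
    let C := Cyl (wordDist (A : Set G)) S (6 * δ) (2 * δ)
    let E : Set G := {p | wordDist (A : Set G) x p ≤ gp (wordDist (A : Set G)) x y z ∧
      ¬ (p ∈ C x y ↔ p ∈ C x z)}
    have huniq : ∀ p ∈ E, ∀ q ∈ E, p⁻¹ * q ∈ H → p = q := by
      have main : ∀ p ∈ E, ∀ q ∈ E, p⁻¹ * q ∈ H →
          wordDist (A : Set G) x p ≤ wordDist (A : Set G) x q → p = q := by
        intro p hp q hq hpq hle
        by_contra hne
        refine hp.2 (exceptional_unique hs hyp hδ (by linarith) (by linarith)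
          (N := 100 * δ + 1) (by linarith) hsep hS hpq (Ne.symm hne) ?_ hq.1 hle)
        have := hq.2
        by_contra hc
        simp only [not_or] at hc
        exact this ⟨fun h => absurd h hc.1, fun h => absurd h hc.2⟩
      intro p hp q hq hpq
      rcases le_total (wordDist (A : Set G) x p) (wordDist (A : Set G) x q) with h | h
      · exact main p hp q hq hpq h
      · refine (main q hq p hp ?_ h).symm
        have := H.inv_mem hpq
        simpa using this
    have hex : ∀ c : G ⧸ H, ∃ b : G, ∀ p ∈ E, (QuotientGroup.mk p : G ⧸ H) = c → p = b := by
      intro c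
      by_cases h : ∃ b ∈ E, (QuotientGroup.mk b : G ⧸ H) = c
      · obtain ⟨b, hb, rfl⟩ := h
        exact ⟨b, fun p hp hpc => huniq p hp b hb (QuotientGroup.eq.1 hpc)⟩
      · exact ⟨1, fun p hp hpc => absurd ⟨p, hp, hpc⟩ h⟩
    choose b hb using hex
    let e := Finite.equivFin (G ⧸ H)
    refine ⟨fun i => b (e.symm i), ?_⟩
    have hE : ∀ p, p ∉ (⋃ i, rball (wordDist (A : Set G)) (b (e.symm i)) 0) → p ∉ E := by
      intro p hp hpE
      apply hp
      refine mem_iUnion.2 ⟨e (QuotientGroup.mk p), ?_⟩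
      have := hb (QuotientGroup.mk p) p hpE rfl
      simp only [Equiv.symm_apply_apply]
      rw [← this]
      exact (wordDist_self _ p).le
    ext p
    constructor
    · rintro ⟨⟨h1, h2⟩, h3⟩
      have := hE p h3
      exact ⟨⟨by_contra fun h => this ⟨h2, fun hh => h (hh.1 h1)⟩, h2⟩, h3⟩
    · rintro ⟨⟨h1, h2⟩, h3⟩
      have := hE p h3
      exact ⟨⟨by_contra fun h => this ⟨h2, fun hh => h (hh.2 h1)⟩, h2⟩, h3⟩


end GSC
end

section
/- With T a δ-hyperbolic quasitree, W its walls from K-balls (K > 100δ, every K-ball disconnects T) and D the disparate-chain dualisable system: the space (T, d_D) is 11-coarsely dense in the dual space T_D; in particular T_D is a quasitree and the inclusion T → T_D is quasimedian. Moreover, any group acting by isometries on (T,d) acts by isometries on T_D. -/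
/-!
Common definitions: coarse geometry (hyperbolicity, rough geodesics, stable cylinders,
quasi-isometries, quasitrees, coarse medians), word metrics, spaces with walls,
dualisable systems and their dual spaces, walls of quasitrees coming from balls,
and the induced wall structures on images of spaces in products of quasitrees.
-/

open Set Metric

namespace GSC

universe u v w

variable {X Y : Type*}

/-! ### Walls of a quasitree coming from balls -/

variable (T : Type*) [MetricSpace T]

/-! ### The image of a space in a product of dual quasitrees, and its walls -/

variable {m : ℕ}

/-! ### Intervals, distant walls and gates in the dual space `S_C` -/

variable {Z : Type*}

/-! ### Geometry: the crossing inequality -/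

/-- The only geometric input used about the walls. -/
structure Geo (T : Type u) [MetricSpace T] (K : ℝ) : Prop where
  pos : 0 < K
  cross : ∀ b h, wallFromBall T K b h → ∀ p ∈ h, ∀ q ∉ h,
    dist p b + dist b q ≤ dist p q + 2 * K
  mid : ∀ x y : T, ∃ m, dist x m = dist x y / 2 ∧ dist m y = dist x y / 2

theorem geo_exists {T : Type u} [MetricSpace T]
    (hgeo : RGSpace (fun a b : T => dist a b) 0) (x y : T) :
    ∃ γ : ℝ → T, γ 0 = x ∧ γ (dist x y) = y ∧
      ∀ s ∈ Icc 0 (dist x y), ∀ t ∈ Icc 0 (dist x y), dist (γ s) (γ t) = |s - t| := by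
  obtain ⟨γ, a, b, hab, ha, hb, h⟩ := hgeo x y
  have h' : ∀ s ∈ Icc a b, ∀ t ∈ Icc a b, dist (γ s) (γ t) = |s - t| := by
    intro s hs t ht
    have := abs_nonpos_iff.1 (h s hs t ht)
    linarith
  have hd : dist x y = b - a := by
    rw [← ha, ← hb, h' a (left_mem_Icc.2 hab) b (right_mem_Icc.2 hab), abs_sub_comm,
      abs_of_nonneg (by linarith)]
  refine ⟨fun s => γ (a + s), by simpa using ha, ?_, ?_⟩
  · simp only [hd]
    rw [show a + (b - a) = b by ring, hb]
  · intro s hs t ht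
    rw [hd] at hs ht
    rw [h' (a + s) ⟨by linarith [hs.1], by linarith [hs.2]⟩ (a + t)
      ⟨by linarith [ht.1], by linarith [ht.2]⟩]
    congr 1; ring

theorem wall_compl {T : Type u} [MetricSpace T] {K : ℝ} {b : T} {h : Set T}
    (hw : wallFromBall T K b h) : wallFromBall T K b hᶜ := by
  obtain ⟨C, hC, h1 | h1 | h1 | h1⟩ := hw
  · exact ⟨C, hC, Or.inr (Or.inl (by rw [h1]))⟩
  · exact ⟨C, hC, Or.inl (by rw [h1, compl_compl])⟩
  · exact ⟨C, hC, Or.inr (Or.inr (Or.inr (by rw [h1])))⟩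
  · exact ⟨C, hC, Or.inr (Or.inr (Or.inl (by rw [h1, compl_compl])))⟩

theorem wall_conn {T : Type u} [MetricSpace T] {K : ℝ} {b : T} {h : Set T}
    (hw : wallFromBall T K b h) {S : Set T} (hS : IsPreconnected S)
    (hd : S ⊆ (closedBall b K)ᶜ) {p q : T} (hp : p ∈ S) (hq : q ∈ S) (hph : p ∈ h) : q ∈ h := by
  obtain ⟨C, ⟨r, hr, rfl⟩, h1⟩ := hw
  have key : ∀ u ∈ S, ∀ v ∈ S, u ∈ connectedComponentIn (closedBall b K)ᶜ r →
      v ∈ connectedComponentIn (closedBall b K)ᶜ r := by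
    intro u hu v hv hur
    rw [connectedComponentIn_eq hur]
    exact hS.subset_connectedComponentIn hu hd hv
  have hpB := hd hp
  have hqB := hd hq
  have k1 := key p hp q hq
  have k2 := key q hq p hp
  rcases h1 with rfl | rfl | rfl | rfl
  · exact k1 hph
  · exact fun hh => hph (k2 hh)
  · exact Or.inl (k1 (hph.resolve_right hpB))
  · exact fun hh => hph (Or.inl (k2 (hh.resolve_right hqB)))

theorem geo_of {T : Type u} [MetricSpace T] {K : ℝ} (hK : 0 < K)
    (hgeo : RGSpace (fun a b : T => dist a b) 0) : Geo T K := by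
  refine ⟨hK, ?_, ?_⟩
  · intro b h hw p hp q hq
    obtain ⟨γ, h0, h1, hγ⟩ := geo_exists hgeo p q
    have hL : (0:ℝ) ≤ dist p q := dist_nonneg
    by_contra hcon
    push Not at hcon
    refine hq (wall_conn hw (S := γ '' Icc 0 (dist p q)) ?_ ?_ ⟨0, ⟨le_rfl, hL⟩, h0⟩
      ⟨_, ⟨hL, le_rfl⟩, h1⟩ hp)
    · refine isPreconnected_Icc.image _ ?_
      have : LipschitzOnWith 1 γ (Icc 0 (dist p q)) := by
        refine LipschitzOnWith.of_dist_le_mul ?_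
        intro s hs t ht
        rw [hγ s hs t ht, Real.dist_eq]; simp
      exact this.continuousOn
    · rintro _ ⟨s, hs, rfl⟩ hB
      rw [mem_closedBall] at hB
      have e1 := hγ 0 ⟨le_rfl, hL⟩ s hs
      have e2 := hγ s hs _ ⟨hL, le_rfl⟩
      rw [h0, abs_sub_comm, abs_of_nonneg (by linarith [hs.1])] at e1
      rw [h1, abs_sub_comm, abs_of_nonneg (by linarith [hs.2])] at e2
      have t1 := dist_triangle p (γ s) b
      have t2 := dist_triangle b (γ s) q
      rw [dist_comm b (γ s)] at t2
      linarith
  · intro x y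
    obtain ⟨γ, h0, h1, hγ⟩ := geo_exists hgeo x y
    have hL : (0:ℝ) ≤ dist x y := dist_nonneg
    have hm : dist x y / 2 ∈ Icc 0 (dist x y) := ⟨by linarith, by linarith⟩
    refine ⟨γ (dist x y / 2), ?_, ?_⟩
    · have e1 := hγ 0 ⟨le_rfl, hL⟩ _ hm
      rw [h0, abs_sub_comm, abs_of_nonneg (by linarith)] at e1
      linarith
    · have e2 := hγ _ hm _ ⟨hL, le_rfl⟩
      rw [h1, abs_sub_comm, abs_of_nonneg (by linarith)] at e2
      linarith

/-- Walls with far-apart balls whose minus sides are disjoint. -/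
theorem Geo.disj {T : Type u} [MetricSpace T] {K : ℝ} (G : Geo T K) {b b' : T} {h h' : Set T}
    (hw : wallFromBall T K b h) (hw' : wallFromBall T K b' h') (hd : 2 * K < dist b b')
    (h1 : b' ∉ h) (h2 : b ∉ h') (q : T) (hq : q ∈ h) : q ∉ h' := by
  intro hq'
  have c1 := G.cross b h hw q hq b' h1
  have c2 := G.cross b' h' hw' q hq' b h2
  rw [dist_comm b' b] at c2
  linarith

theorem Geo.meet {T : Type u} [MetricSpace T] {K : ℝ} (G : Geo T K) {b b' : T} {h h' : Set T}
    (hw : wallFromBall T K b h) (hw' : wallFromBall T K b' h') (hd : 2 * K < dist b b')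
    (h1 : b' ∈ h) (h2 : b ∈ h') : (h ∩ h').Nonempty := by
  obtain ⟨m, m1, m2⟩ := G.mid b b'
  refine ⟨m, ?_, ?_⟩
  · by_contra hm
    have c1 := G.cross b h hw b' h1 m hm
    rw [dist_comm b' b, dist_comm b' m] at c1
    linarith
  · by_contra hm
    have c1 := G.cross b' h' hw' b h2 m hm
    rw [dist_comm b' m] at c1
    linarith

/-- Two walls separating a pair of ultrafilters, with far balls, are strictly nested. -/
theorem Geo.nested {T : Type u} [MetricSpace T] {K : ℝ} (G : Geo T K) {b b' : T} {h h' : Set T}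
    (hw : wallFromBall T K b h) (hw' : wallFromBall T K b' h') (hd : 2 * K < dist b b')
    {x y : Set (Set T)} (hx : IsUF (ballWalls T K) x) (hy : IsUF (ballWalls T K) y)
    (h1 : h ∈ x) (h1' : h' ∈ x) (h2 : h ∉ y) (h2' : h' ∉ y) : h ⊂ h' ∨ h' ⊂ h := by
  have hd' : 2 * K < dist b' b := by rwa [dist_comm]
  by_cases s : b' ∈ h
  · by_cases s' : b ∈ h'
    · exfalso
      have hc : hᶜ ∈ y := by
        by_contra hh
        exact h2 ((hy.2.1 h ⟨b, hw⟩).2 hh)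
      refine h2' (hy.2.2 _ hc h' ⟨b', hw'⟩ ?_)
      intro q hq
      by_contra hq'
      exact G.disj (wall_compl hw) (wall_compl hw') hd (by simpa using s) (by simpa using s')
        q hq hq'
    · right
      refine ⟨?_, ?_⟩
      · intro q hq
        by_contra hq'
        exact G.disj (wall_compl hw) hw' hd (by simpa using s) s' q hq' hq
      · intro hs
        obtain ⟨m, m1, m2⟩ := G.meet hw (wall_compl hw') hd s s'
        exact m2 (hs m1)
  · by_cases s' : b ∈ h'
    · left
      refine ⟨?_, ?_⟩
      · intro q hq
        by_contra hq'
        exact G.disj hw (wall_compl hw') hd s (by simpa using s') q hq hq'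
      · intro hs
        obtain ⟨m, m1, m2⟩ := G.meet (wall_compl hw) hw' hd s s'
        exact m1 (hs m2)
    · exfalso
      have : h'ᶜ ∈ x := hx.2.2 _ h1 _ ⟨b', wall_compl hw'⟩
        (fun q hq => G.disj hw hw' hd s s' q hq)
      exact (hx.2.1 h' ⟨b', hw'⟩).1 h1' this

theorem Geo.card_le {T : Type u} [MetricSpace T] {K : ℝ} (G : Geo T K) {ι : Type*} (s : Finset ι)
    (b : ι → T) (h : ι → Set T) (hw : ∀ i ∈ s, wallFromBall T K (b i) (h i))
    (hfar : ∀ i ∈ s, ∀ j ∈ s, i ≠ j → 10 * K ≤ dist (b i) (b j))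
    {x y : Set (Set T)} (hx : IsUF (ballWalls T K) x) (hy : IsUF (ballWalls T K) y)
    (hsep : ∀ i ∈ s, (h i ∈ x ↔ h i ∉ y)) : (s.card : ℕ∞) ≤ dD (disparateChains T K) x y := by
  classical
  have hK := G.pos
  rcases s.eq_empty_or_nonempty with hs0 | ⟨i0, hi0⟩
  · simp [hs0]
  set σ : Set T → Set T := fun k => if k ∈ x then k else kᶜ with hσ
  have hσx : ∀ i ∈ s, wallFromBall T K (b i) (σ (h i)) ∧ σ (h i) ∈ x ∧ σ (h i) ∉ y := by
    intro i hi
    by_cases hh : h i ∈ x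
    · simp only [hσ, hh, if_true]
      exact ⟨hw i hi, trivial, (hsep i hi).1 hh⟩
    · simp only [hσ, hh, if_false]
      refine ⟨wall_compl (hw i hi), ?_, ?_⟩
      · by_contra h3
        exact hh ((hx.2.1 _ ⟨_, hw i hi⟩).2 h3)
      · refine (hy.2.1 _ ⟨_, hw i hi⟩).1 ?_
        by_contra h3
        exact hh ((hsep i hi).2 h3)
  have hnest : ∀ i ∈ s, ∀ j ∈ s, i ≠ j → σ (h i) ⊂ σ (h j) ∨ σ (h j) ⊂ σ (h i) := by
    intro i hi j hj hij
    obtain ⟨a1, a2, a3⟩ := hσx i hi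
    obtain ⟨b1, b2, b3⟩ := hσx j hj
    exact G.nested a1 b1 (by linarith [hfar i hi j hj hij]) hx hy a2 b2 a3 b3
  have hinj : Set.InjOn h s := by
    intro i hi j hj hij
    by_contra hne
    rcases hnest i hi j hj hne with hh | hh
    · rw [hij] at hh; exact hh.2 le_rfl
    · rw [hij] at hh; exact hh.2 le_rfl
  have hcard : (h '' (s : Set ι)).encard = s.card := by
    rw [hinj.encard_image, Set.encard_coe_eq_coe_finsetCard]
  rw [← hcard]
  refine le_iSup₂_of_le (f := fun (c : Set (Set T))
    (_ : c ∈ disparateChains T K ∧ Seps x y c) => c.encard) (h '' s) ⟨⟨⟨σ, ?_, ?_⟩, ?_⟩, ?_⟩ le_rfl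
  · intro k _
    by_cases hk : k ∈ x <;> simp [hσ, hk]
  · rintro _ ⟨i, hi, rfl⟩ _ ⟨j, hj, rfl⟩ hij
    exact hnest i hi j hj (fun e => hij (by rw [e]))
  · refine ⟨fun k => if hk : ∃ i ∈ s, h i = k then b hk.choose else b i0, ?_, ?_⟩
    · rintro _ ⟨i, hi, rfl⟩
      have hk : ∃ j ∈ s, h j = h i := ⟨i, hi, rfl⟩
      beta_reduce
      rw [dif_pos hk]
      have := hw _ hk.choose_spec.1
      rwa [hk.choose_spec.2] at this
    · rintro _ ⟨i, hi, rfl⟩ _ ⟨j, hj, rfl⟩ hij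
      have hk : ∃ j ∈ s, h j = h i := ⟨i, hi, rfl⟩
      have hk' : ∃ i ∈ s, h i = h j := ⟨j, hj, rfl⟩
      beta_reduce
      rw [dif_pos hk, dif_pos hk']
      refine hfar _ hk.choose_spec.1 _ hk'.choose_spec.1 ?_
      intro e
      apply hij
      rw [← hk.choose_spec.2, ← hk'.choose_spec.2, e]
  · rintro _ ⟨i, hi, rfl⟩
    exact hsep i hi

/-! ### Walls oriented away from a base point, and their depth -/

/-- A wall with a chosen defining ball, oriented away from `o`. -/
structure OW (T : Type u) [MetricSpace T] (K : ℝ) (o : T) where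
  b : T
  h : Set T
  hw : wallFromBall T K b h
  ho : o ∉ h

/-- The second wall is strictly behind the first. -/
def OW.lt {T : Type u} [MetricSpace T] {K : ℝ} {o : T} (w w' : OW T K o) : Prop :=
  2 * K < dist w.b w'.b ∧ w'.b ∈ w.h ∧ w.b ∉ w'.h

def OW.ll {T : Type u} [MetricSpace T] {K : ℝ} {o : T} (w w' : OW T K o) : Prop :=
  10 * K ≤ dist w.b w'.b ∧ w'.b ∈ w.h ∧ w.b ∉ w'.h

theorem OW.mem {T : Type u} [MetricSpace T] {K : ℝ} {o : T} (w : OW T K o) :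
    w.h ∈ ballWalls T K := ⟨w.b, w.hw⟩

section depth

variable {T : Type u} [MetricSpace T] {K : ℝ} {o : T}

theorem Geo.tri (G : Geo T K) (w w' : OW T K o) (hd : 2 * K < dist w.b w'.b) :
    w.lt w' ∨ w'.lt w ∨ (w.b ∉ w'.h ∧ w'.b ∉ w.h ∧ Disjoint w.h w'.h) := by
  have hd' : 2 * K < dist w'.b w.b := by rwa [dist_comm]
  by_cases s : w'.b ∈ w.h
  · by_cases s' : w.b ∈ w'.h
    · exact absurd w'.ho (G.disj (wall_compl w.hw) (wall_compl w'.hw) hd (by simpa using s)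
        (by simpa using s') o w.ho)
    · exact Or.inl ⟨hd, s, s'⟩
  · by_cases s' : w.b ∈ w'.h
    · exact Or.inr (Or.inl ⟨hd', s', s⟩)
    · exact Or.inr (Or.inr ⟨s', s, Set.disjoint_left.2 (G.disj w.hw w'.hw hd s s')⟩)

theorem Geo.lt_sub (G : Geo T K) {w w' : OW T K o} (h : w.lt w') : w'.h ⊆ w.h := by
  intro q hq
  by_contra hq'
  exact G.disj (wall_compl w.hw) w'.hw h.1 (by simpa using h.2.1) h.2.2 q hq' hq

theorem Geo.ll_lt (G : Geo T K) {w w' : OW T K o} (h : w.ll w') : w.lt w' :=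
  ⟨by linarith [G.pos, h.1], h.2⟩

theorem Geo.ll_lt_ll (G : Geo T K) {w w' w'' : OW T K o} (h : w.ll w') (h' : w'.lt w'') :
    w.ll w'' := by
  refine ⟨?_, G.lt_sub (G.ll_lt h) h'.2.1, fun hh => h.2.2 (G.lt_sub h' hh)⟩
  have := G.cross _ _ w'.hw w''.b h'.2.1 w.b h.2.2
  have h1 := h.1
  have h2 := h'.1
  rw [dist_comm w''.b w'.b, dist_comm w'.b w.b, dist_comm w''.b w.b] at this
  linarith

theorem Geo.ll_near (G : Geo T K) {w w' w'' : OW T K o} (h : w.ll w')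
    (h' : dist w'.b w''.b ≤ 2 * K) : w.lt w'' := by
  have hK := G.pos
  have h1 := h.1
  have hd : 2 * K < dist w.b w''.b := by
    have := dist_triangle w.b w''.b w'.b
    rw [dist_comm w''.b] at this
    linarith
  have hm : w''.b ∈ w.h := by
    by_contra hh
    have := G.cross _ _ w.hw w'.b h.2.1 w''.b hh
    rw [dist_comm w'.b w.b] at this
    linarith
  rcases G.tri w w'' hd with h3 | h3 | h3
  · exact h3
  · exact absurd hm h3.2.2
  · exact absurd hm h3.2.1

/-- `w` has depth at least `n`. -/
def Dge : ℕ → OW T K o → Prop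
  | 0, _ => True
  | n + 1, w => ∃ w', OW.ll w' w ∧ Dge n w'

theorem Geo.dge_dist (G : Geo T K) (n : ℕ) : ∀ w : OW T K o, Dge n w →
    8 * K * n ≤ dist o w.b := by
  induction n with
  | zero => intro w _; simp
  | succ n ih =>
    rintro w ⟨w', h, hw'⟩
    have h1 := ih w' hw'
    have h2 := G.cross _ _ w'.hw w.b h.2.1 o w'.ho
    have h3 := h.1
    rw [dist_comm w.b w'.b, dist_comm w'.b o, dist_comm w.b o] at h2
    push_cast
    linarith

theorem Geo.dge_anti (G : Geo T K) (n : ℕ) : ∀ w : OW T K o, Dge (n + 1) w → Dge n w := by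
  induction n with
  | zero => intro w _; trivial
  | succ n ih =>
    rintro w ⟨w', h, hw'⟩
    exact ⟨w', h, ih w' hw'⟩

noncomputable def dep (w : OW T K o) : ℕ := sSup {n | Dge n w}

theorem Geo.bdd (G : Geo T K) (w : OW T K o) : BddAbove {n | Dge n w} := by
  refine ⟨⌊dist o w.b / (8 * K)⌋₊, ?_⟩
  intro n hn
  have := G.dge_dist n w hn
  have hK := G.pos
  refine Nat.le_floor ?_
  rw [le_div_iff₀ (by linarith)]
  linarith

theorem Geo.dge_dep (G : Geo T K) (w : OW T K o) : Dge (dep w) w :=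
  Nat.sSup_mem (s := {n | Dge n w}) ⟨0, (trivial : Dge 0 w)⟩ (G.bdd w)

theorem Geo.le_dep (G : Geo T K) {w : OW T K o} {n : ℕ} (h : Dge n w) : n ≤ dep w :=
  le_csSup (G.bdd w) h

theorem Geo.dep_dist (G : Geo T K) (w : OW T K o) : 8 * K * dep w ≤ dist o w.b :=
  G.dge_dist _ w (G.dge_dep w)

theorem Geo.dep_ll (G : Geo T K) {w w' : OW T K o} (h : w.ll w') : dep w + 1 ≤ dep w' :=
  G.le_dep ⟨w, h, G.dge_dep w⟩

theorem Geo.dep_lt (G : Geo T K) {w w' : OW T K o} (h : w.lt w') : dep w ≤ dep w' := by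
  have h1 := G.dge_dep w
  apply G.le_dep
  cases hn : dep w with
  | zero => trivial
  | succ n =>
    rw [hn] at h1
    obtain ⟨v, hv, hv'⟩ := h1
    exact ⟨v, G.ll_lt_ll hv h, hv'⟩

theorem Geo.dep_near (G : Geo T K) {w w' : OW T K o} (h : dist w.b w'.b ≤ 2 * K) :
    dep w ≤ dep w' + 1 := by
  have h1 := G.dge_dep w
  cases hn : dep w with
  | zero => omega
  | succ n =>
    rw [hn] at h1
    obtain ⟨v, hv, hv'⟩ := h1
    have := G.dep_lt (G.ll_near hv h)
    have := G.le_dep hv'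
    omega

theorem Geo.pred (G : Geo T K) {w : OW T K o} {n : ℕ} (h : dep w = n + 1) :
    ∃ w', OW.ll w' w ∧ dep w' = n := by
  have h1 := G.dge_dep w
  rw [h] at h1
  obtain ⟨v, hv, hv'⟩ := h1
  refine ⟨v, hv, ?_⟩
  have := G.dep_ll hv
  have := G.le_dep hv'
  omega

theorem Geo.chain (G : Geo T K) (n : ℕ) : ∀ w : OW T K o, dep w = n →
    ∃ g : ℕ → OW T K o, g n = w ∧ (∀ i ≤ n, dep (g i) = i) ∧
      ∀ i j, i < j → j ≤ n → (g i).ll (g j) := by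
  induction n with
  | zero => exact fun w hw => ⟨fun _ => w, rfl, fun i hi => by simp [hw, Nat.le_zero.1 hi],
      fun i j h1 h2 => by omega⟩
  | succ n ih =>
    intro w hw
    obtain ⟨w', h1, h2⟩ := G.pred hw
    obtain ⟨g, g1, g2, g3⟩ := ih w' h2
    refine ⟨fun i => if i ≤ n then g i else w, by simp, ?_, ?_⟩
    · intro i hi
      by_cases h : i ≤ n
      · simp [h, g2 i h]
      · simp [h, hw]; omega
    · intro i j hij hj
      have hi : i ≤ n := by omega
      by_cases h : j ≤ n
      · simpa [h, hi] using g3 i j hij h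
      · simp only [hi, h, if_true, if_false]
        rcases hi.lt_or_eq with h4 | h4
        · exact G.ll_lt_ll (g3 i n h4 le_rfl) (by rw [g1]; exact G.ll_lt h1)
        · rw [h4, g1]; exact h1

/-- Comparison of two walls chosen by the same ultrafilter. -/
theorem Geo.comp (G : Geo T K) {x : Set (Set T)} (hx : IsUF (ballWalls T K) x) (w w' : OW T K o)
    (h : w.h ∈ x) (h' : w'.h ∈ x) : dist w.b w'.b ≤ 2 * K ∨ w.lt w' ∨ w'.lt w := by
  by_cases hd : dist w.b w'.b ≤ 2 * K
  · exact Or.inl hd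
  · rcases G.tri w w' (not_le.1 hd) with h3 | h3 | h3
    · exact Or.inr (Or.inl h3)
    · exact Or.inr (Or.inr h3)
    · exfalso
      have : w'.hᶜ ∈ x := hx.2.2 _ h _ ⟨w'.b, wall_compl w'.hw⟩
        (Set.disjoint_left.1 h3.2.2)
      exact (hx.2.1 _ w'.mem).1 h' this

theorem Geo.down (G : Geo T K) {x : Set (Set T)} (hx : IsUF (ballWalls T K) x) {w w' : OW T K o}
    (h : w.lt w') (h' : w'.h ∈ x) : w.h ∈ x := hx.2.2 _ h' _ w.mem (G.lt_sub h)

theorem Geo.comp2 (G : Geo T K) {x : Set (Set T)} (hx : IsUF (ballWalls T K) x) {w w' : OW T K o}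
    (h : w.h ∈ x) (h' : w'.h ∈ x) (hd : dep w + 2 ≤ dep w') : w.lt w' := by
  rcases G.comp hx w w' h h' with h3 | h3 | h3
  · rw [dist_comm] at h3
    have := G.dep_near h3
    omega
  · exact h3
  · have := G.dep_lt h3
    omega

theorem isUF_pUF (s : T) : IsUF (ballWalls T K) (pUF (ballWalls T K) s) := by
  refine ⟨fun h hh => hh.1, ?_, fun h hh k hk hhk => ⟨hk, hhk hh.2⟩⟩
  intro h hh
  constructor
  · exact fun h1 h2 => h2.2 h1.2
  · intro h1
    refine ⟨hh, ?_⟩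
    by_contra h2
    obtain ⟨t, ht⟩ := hh
    exact h1 ⟨⟨t, wall_compl ht⟩, h2⟩

theorem Geo.inj (G : Geo T K) {x : Set (Set T)} (hx : IsUF (ballWalls T K) x)
    {c : Set (Set T)} (f : Set T → OW T K o)
    (hf : ∀ h ∈ c, ∀ k ∈ c, h ≠ k → 10 * K ≤ dist (f h).b (f k).b)
    (hfx : ∀ h ∈ c, (f h).h ∈ x) (A B : ℕ) (hAB : ∀ h ∈ c, A ≤ dep (f h) ∧ dep (f h) < B) :
    c.encard ≤ ((B - A : ℕ) : ℕ∞) := by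
  have hinj : Set.InjOn (fun h => dep (f h)) c := by
    intro h hh k hk hhk
    by_contra hne
    have h1 := hf h hh k hk hne
    have hK := G.pos
    simp only at hhk
    rcases G.comp hx _ _ (hfx h hh) (hfx k hk) with h3 | h3 | h3
    · linarith
    · have := G.dep_ll (w := f h) (w' := f k) ⟨h1, h3.2⟩
      omega
    · have := G.dep_ll (w := f k) (w' := f h) ⟨by rwa [dist_comm], h3.2⟩
      omega
  rw [← hinj.encard_image]
  calc _ ≤ (↑(Finset.Ico A B) : Set ℕ).encard := by
        apply Set.encard_le_encard
        rintro _ ⟨h, hh, rfl⟩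
        simpa using hAB h hh
    _ = _ := by rw [Set.encard_coe_eq_coe_finsetCard]; simp

/-- Orienting the walls of a disparate chain away from `o`. -/
theorem orient (o : T) {c : Set (Set T)} (hc : c ∈ disparateChains T K) (x y : Set (Set T))
    (hx : IsUF (ballWalls T K) x) (hyc : ∀ h ∈ ballWalls T K, (h ∈ y ↔ hᶜ ∉ y)) (hs : Seps x y c)
    (hne : c.Nonempty) :
    ∃ f : Set T → OW T K o,
      (∀ h ∈ c, ∀ k ∈ c, h ≠ k → 10 * K ≤ dist (f h).b (f k).b) ∧
      ∀ h ∈ c, ((f h).h ∈ x ↔ (f h).h ∉ y) := by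
  classical
  obtain ⟨-, β, h1, h2⟩ := hc
  have key : ∀ h ∈ c, ∃ w : OW T K o, w.b = β h ∧ (w.h ∈ x ↔ w.h ∉ y) := by
    intro h hh
    by_cases ho : o ∈ h
    · refine ⟨⟨β h, hᶜ, wall_compl (h1 h hh), fun h3 => h3 ho⟩, rfl, ?_⟩
      have a1 := hx.2.1 h ⟨_, h1 h hh⟩
      have a2 := hyc h ⟨_, h1 h hh⟩
      have a3 := hs h hh
      simp only
      tauto
    · exact ⟨⟨β h, h, h1 h hh, ho⟩, rfl, hs h hh⟩
  obtain ⟨h0, hh0⟩ := hne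
  refine ⟨fun h => if hh : h ∈ c then (key h hh).choose else (key h0 hh0).choose, ?_, ?_⟩
  · intro h hh k hk hne
    simp only [hh, hk, dif_pos]
    rw [(key h hh).choose_spec.1, (key k hk).choose_spec.1]
    exact h2 h hh k hk hne
  · intro h hh
    simp only [hh, dif_pos]
    exact (key h hh).choose_spec.2

end depth

/-! ### The Gromov-product-like quantity on the dual space -/

section dual

variable {T : Type u} [MetricSpace T] {K : ℝ} {o : T}


theorem mem_pUF {s : T} (w : OW T K o) : w.h ∈ pUF (ballWalls T K) s ↔ s ∈ w.h :=
  ⟨fun h => h.2, fun h => ⟨w.mem, h⟩⟩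

theorem Geo.dep_le_dD (G : Geo T K) {x : Set (Set T)} (hx : IsUF (ballWalls T K) x) (w : OW T K o)
    (h : w.h ∈ x) : ((dep w + 1 : ℕ) : ℕ∞) ≤
      dD (disparateChains T K) x (pUF (ballWalls T K) o) := by
  obtain ⟨g, g1, g2, g3⟩ := G.chain _ w rfl
  have := G.card_le (Finset.range (dep w + 1)) (fun i => (g i).b) (fun i => (g i).h)
    (fun i _ => (g i).hw) ?_ hx (isUF_pUF o) ?_
  · simpa using this
  · intro i hi j hj hij
    rw [Finset.mem_range] at hi hj
    rcases lt_or_gt_of_ne hij with h1 | h1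
    · exact (g3 i j h1 (by omega)).1
    · rw [dist_comm]; exact (g3 j i h1 (by omega)).1
  · intro i hi
    rw [Finset.mem_range] at hi
    rw [mem_pUF]
    refine ⟨fun _ => (g i).ho, fun _ => ?_⟩
    rcases (Nat.lt_succ_iff.1 hi).lt_or_eq with h1 | h1
    · exact G.down hx (G.ll_lt (g3 i _ h1 le_rfl)) (by rwa [g1])
    · rw [h1, g1]; exact h

/-- Maximal depth (plus one) of a wall, oriented away from `o`, chosen by both `x` and `y`. -/
noncomputable def gr (K : ℝ) (o : T) (x y : Set (Set T)) : ℕ :=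
  sSup {n | n = 0 ∨ ∃ w : OW T K o, n = dep w + 1 ∧ w.h ∈ x ∧ w.h ∈ y}

/-- `x` is an ultrafilter whose depths are bounded. -/
structure Fin' (K : ℝ) (o : T) (x : Set (Set T)) : Prop where
  uf : IsUF (ballWalls T K) x
  bd : ∃ N : ℕ, ∀ w : OW T K o, w.h ∈ x → dep w + 1 ≤ N

theorem Geo.fin_of (G : Geo T K) (o : T) {x : Set (Set T)}
    (hx : x ∈ dualSpace (ballWalls T K) (disparateChains T K)) : Fin' K o x := by
  refine ⟨hx.1, (dD (disparateChains T K) x (pUF (ballWalls T K) o)).toNat, ?_⟩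
  intro w hw
  have h1 := G.dep_le_dD hx.1 w hw
  have h2 := hx.2 o
  rw [← ENat.coe_toNat h2.ne] at h1
  exact_mod_cast h1

theorem gr_bdd {x : Set (Set T)} (hx : Fin' K o x) (y : Set (Set T)) :
    BddAbove {n | n = 0 ∨ ∃ w : OW T K o, n = dep w + 1 ∧ w.h ∈ x ∧ w.h ∈ y} := by
  obtain ⟨N, hN⟩ := hx.bd
  refine ⟨N, ?_⟩
  rintro n (rfl | ⟨w, rfl, h, -⟩)
  · omega
  · exact hN w h

theorem gr_mem {x : Set (Set T)} (hx : Fin' K o x) (y : Set (Set T)) :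
    gr K o x y = 0 ∨ ∃ w : OW T K o, gr K o x y = dep w + 1 ∧ w.h ∈ x ∧ w.h ∈ y :=
  Nat.sSup_mem ⟨0, Or.inl rfl⟩ (gr_bdd hx y)

theorem le_gr {x y : Set (Set T)} (hx : Fin' K o x) (w : OW T K o) (h1 : w.h ∈ x) (h2 : w.h ∈ y) :
    dep w + 1 ≤ gr K o x y := le_csSup (gr_bdd hx y) (Or.inr ⟨w, rfl, h1, h2⟩)

theorem gr_symm (x y : Set (Set T)) : gr K o x y = gr K o y x := by
  unfold gr
  congr 1
  ext n
  simp only [mem_setOf_eq, and_comm]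

theorem gr_le {x : Set (Set T)} (hx : Fin' K o x) (y : Set (Set T)) :
    gr K o x y ≤ gr K o x x := by
  rcases gr_mem hx y with h | ⟨w, h, h1, h2⟩
  · omega
  · rw [h]; exact le_gr hx w h1 h1

/-- Upper bound on the distance. -/
theorem Geo.dD_le (G : Geo T K) {x y : Set (Set T)} (hx : Fin' K o x) (hy : Fin' K o y) :
    dD (disparateChains T K) x y ≤
      (((gr K o x x - (gr K o x y - 2)) + (gr K o y y - (gr K o x y - 2)) : ℕ) : ℕ∞) := by
  refine iSup₂_le ?_
  rintro c ⟨hc, hs⟩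
  rcases c.eq_empty_or_nonempty with rfl | hne
  · simp
  obtain ⟨f, f1, f2⟩ := orient o hc x y hx.uf hy.uf.2.1 hs hne
  have hcu : c ⊆ {h ∈ c | (f h).h ∈ x} ∪ {h ∈ c | (f h).h ∈ y} := by
    intro h hh
    by_cases h1 : (f h).h ∈ y
    · exact Or.inr ⟨hh, h1⟩
    · exact Or.inl ⟨hh, (f2 h hh).2 h1⟩
  have low : ∀ w : OW T K o, (w.h ∈ x ↔ w.h ∉ y) → gr K o x y - 2 ≤ dep w := by
    intro w hw
    rcases gr_mem hx y with h | ⟨p, h, h1, h2⟩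
    · omega
    · by_contra hlt
      have hd : dep w + 2 ≤ dep p := by omega
      by_cases hwx : w.h ∈ x
      · exact hw.1 hwx (G.down hy.uf (G.comp2 hx.uf hwx h1 hd) h2)
      · have hwy : w.h ∈ y := by
          by_contra hh
          exact hwx (hw.2 hh)
        exact hwx (G.down hx.uf (G.comp2 hy.uf hwy h2 hd) h1)
  have e1 := G.inj hx.uf (c := {h ∈ c | (f h).h ∈ x}) f
    (fun h hh k hk => f1 h hh.1 k hk.1) (fun h hh => hh.2) (gr K o x y - 2) (gr K o x x)
    (fun h hh => ⟨low _ (f2 h hh.1), le_gr hx _ hh.2 hh.2⟩)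
  have e2 := G.inj hy.uf (c := {h ∈ c | (f h).h ∈ y}) f
    (fun h hh k hk => f1 h hh.1 k hk.1) (fun h hh => hh.2) (gr K o x y - 2) (gr K o y y)
    (fun h hh => ⟨low _ (f2 h hh.1), le_gr hy _ hh.2 hh.2⟩)
  calc c.encard ≤ _ := Set.encard_le_encard hcu
    _ ≤ _ := Set.encard_union_le _ _
    _ ≤ _ := add_le_add e1 e2
    _ = _ := by push_cast; rfl

theorem Geo.far (G : Geo T K) {x y : Set (Set T)} (hx : IsUF (ballWalls T K) x)
    (hy : IsUF (ballWalls T K) y) {a a' b b' : OW T K o} (h1 : a'.ll a) (h2 : b'.ll b)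
    (ha' : a'.h ∈ x) (hay' : a'.h ∉ y) (hb : b.h ∈ y) (hbx : b.h ∉ x)
    (hbx' : b'.h ∉ x) : 10 * K ≤ dist a.b b.b := by
  by_contra hlt
  push Not at hlt
  by_cases hs : dist b.b a'.b ≤ 2 * K
  · exact hbx' (G.down hx (G.ll_near h2 hs) ha')
  · push Not at hs
    rcases G.tri b a' hs with h3 | h3 | h3
    · exact hbx (G.down hx h3 ha')
    · exact hay' (G.down hy h3 hb)
    · have := G.cross _ _ a'.hw a.b h1.2.1 b.b h3.1
      have h4 := h1.1
      rw [dist_comm a'.b b.b, dist_comm a.b a'.b] at this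
      linarith

/-- The chain of walls from `o` to `x`. -/
theorem Geo.chainTo (G : Geo T K) {x : Set (Set T)} (hx : Fin' K o x) (hpos : 0 < gr K o x x) :
    ∃ g : ℕ → OW T K o, (∀ i < gr K o x x, dep (g i) = i ∧ (g i).h ∈ x) ∧
      ∀ i j, i < j → j < gr K o x x → (g i).ll (g j) := by
  rcases gr_mem hx x with h | ⟨w, h, h1, -⟩
  · omega
  · obtain ⟨g, g1, g2, g3⟩ := G.chain _ w rfl
    refine ⟨g, ?_, fun i j hij hj => g3 i j hij (by omega)⟩
    intro i hi
    refine ⟨g2 i (by omega), ?_⟩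
    rcases (show i ≤ dep w by omega).lt_or_eq with h2 | h2
    · exact G.down hx.uf (G.ll_lt (g3 i _ h2 le_rfl)) (by rwa [g1])
    · rw [h2, g1]; exact h1

/-- Lower bound on the distance. -/
theorem Geo.le_dD (G : Geo T K) {x y : Set (Set T)} (hx : Fin' K o x) (hy : Fin' K o y) :
    (((gr K o x x - (gr K o x y + 1)) + (gr K o y y - (gr K o x y + 1)) : ℕ) : ℕ∞) ≤
      dD (disparateChains T K) x y := by
  set n := gr K o x y with hn
  by_cases ho : Nonempty (OW T K o)
  swap
  · have e1 : gr K o x x = 0 := by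
      rcases gr_mem hx x with h | ⟨w, -⟩
      · exact h
      · exact absurd ⟨w⟩ ho
    have e2 : gr K o y y = 0 := by
      rcases gr_mem hy y with h | ⟨w, -⟩
      · exact h
      · exact absurd ⟨w⟩ ho
    simp [e1, e2]
  obtain ⟨w0⟩ := ho
  have chain : ∀ z, Fin' K o z → ∃ g : ℕ → OW T K o,
      (∀ i < gr K o z z, dep (g i) = i ∧ (g i).h ∈ z) ∧
      ∀ i j, i < j → j < gr K o z z → (g i).ll (g j) := by
    intro z hz
    by_cases h : 0 < gr K o z z
    · exact G.chainTo hz h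
    · exact ⟨fun _ => w0, fun i hi => by omega, fun i j h1 h2 => by omega⟩
  obtain ⟨g, g1, g2⟩ := chain x hx
  obtain ⟨k, k1, k2⟩ := chain y hy
  have gy : ∀ i, n ≤ i → i < gr K o x x → (g i).h ∉ y := by
    intro i hi hi' hh
    have := le_gr hx (g i) (g1 i hi').2 hh
    rw [(g1 i hi').1] at this
    omega
  have kx : ∀ i, n ≤ i → i < gr K o y y → (k i).h ∉ x := by
    intro i hi hi' hh
    have := le_gr hx (k i) hh (k1 i hi').2
    rw [(k1 i hi').1] at this
    omega
  have hcross : ∀ i j, n + 1 ≤ i → i < gr K o x x → n + 1 ≤ j → j < gr K o y y →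
      10 * K ≤ dist (g i).b (k j).b := by
    intro i j hi hi' hj hj'
    exact G.far hx.uf hy.uf (g2 (i-1) i (by omega) hi') (k2 (j-1) j (by omega) hj')
      (g1 (i-1) (by omega)).2 (gy (i-1) (by omega) (by omega)) (k1 j hj').2
      (kx j (by omega) hj') (kx (j-1) (by omega) (by omega))
  have := G.card_le ((Finset.Ico (n+1) (gr K o x x)).disjSum (Finset.Ico (n+1) (gr K o y y)))
    (fun i => (Sum.elim g k i).b) (fun i => (Sum.elim g k i).h) (fun i _ => (Sum.elim g k i).hw)
    ?_ hx.uf hy.uf ?_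
  · simpa using this
  · rintro (i | i) hi (j | j) hj hij <;> simp only [Finset.inl_mem_disjSum, Finset.inr_mem_disjSum,
      Finset.mem_Ico, Sum.elim_inl, Sum.elim_inr] at hi hj ⊢
    · rcases lt_or_gt_of_ne (fun e => hij (by rw [e]) : i ≠ j) with h | h
      · exact (g2 i j h hj.2).1
      · rw [dist_comm]; exact (g2 j i h hi.2).1
    · exact hcross i j hi.1 hi.2 hj.1 hj.2
    · rw [dist_comm]; exact hcross j i hj.1 hj.2 hi.1 hi.2
    · rcases lt_or_gt_of_ne (fun e => hij (by rw [e]) : i ≠ j) with h | h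
      · exact (k2 i j h hj.2).1
      · rw [dist_comm]; exact (k2 j i h hi.2).1
  · rintro (i | i) hi <;> simp only [Finset.inl_mem_disjSum, Finset.inr_mem_disjSum,
      Finset.mem_Ico, Sum.elim_inl, Sum.elim_inr] at hi ⊢
    · have a := gy i (by omega) hi.2
      have b := (g1 i hi.2).2
      tauto
    · have a := kx i (by omega) hi.2
      have b := (k1 i hi.2).2
      tauto

/-- Chain version of hyperbolicity. -/
theorem Geo.chain_hyp (G : Geo T K) {X : Type*} (v : X → Set (Set T)) (hv : ∀ a, Fin' K o (v a))
    {n : ℕ} {a b : X} (h : Relation.TransGen (fun a b => n ≤ gr K o (v a) (v b)) a b) :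
    n ≤ gr K o (v a) (v b) + 2 := by
  by_cases hn : n ≤ 2
  · omega
  obtain ⟨c, hc⟩ : ∃ c, n ≤ gr K o (v a) (v c) := by
    rcases Relation.TransGen.head'_iff.1 h with ⟨c, hc, -⟩
    exact ⟨c, hc⟩
  have hpos : n ≤ gr K o (v a) (v a) := hc.trans (gr_le (hv a) _)
  obtain ⟨g, g1, g2⟩ := G.chainTo (hv a) (by omega)
  set p := g (n - 3) with hp
  have hp1 : dep p = n - 3 := (g1 _ (by omega)).1
  have hpa : p.h ∈ v a := (g1 _ (by omega)).2
  have step : ∀ d e, p.h ∈ v d → n ≤ gr K o (v d) (v e) → p.h ∈ v e := by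
    intro d e hd hde
    rcases gr_mem (hv d) (v e) with h3 | ⟨w, h3, h4, h5⟩
    · omega
    · exact G.down (hv e).uf (G.comp2 (hv d).uf hd h4 (by omega)) h5
  have hpb : p.h ∈ v b := by
    clear hpos
    induction h with
    | single h => exact step _ _ hpa h
    | tail h1 h2 ih => exact step _ _ ih h2
  have := le_gr (hv a) p hpa hpb
  omega

/-- The centre of a wall has depth controlled by that of the wall. -/
theorem Geo.centre (G : Geo T K) {w : OW T K o} (hz : Fin' K o (pUF (ballWalls T K) w.b)) :
    gr K o (pUF (ballWalls T K) w.b) (pUF (ballWalls T K) w.b) ≤ dep w + 2 := by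
  rcases gr_mem hz (pUF (ballWalls T K) w.b) with h | ⟨k, h, h1, -⟩
  · omega
  · rw [mem_pUF] at h1
    rw [h]
    by_cases hd : dist k.b w.b ≤ 2 * K
    · have := G.dep_near hd
      omega
    · rcases G.tri k w (not_le.1 hd) with h3 | h3 | h3
      · have := G.dep_lt h3
        omega
      · exact absurd h1 h3.2.2
      · exact absurd h1 h3.2.1

/-- Points of `T` realising intermediate depths. -/
theorem Geo.interm (G : Geo T K) (hp : ∀ t : T, Fin' K o (pUF (ballWalls T K) t))
    {x : Set (Set T)} (hx : Fin' K o x) {n : ℕ} (hn : n < gr K o x x) :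
    ∃ t : T, gr K o (pUF (ballWalls T K) t) (pUF (ballWalls T K) t) ≤ n + 2 ∧
      n ≤ gr K o x (pUF (ballWalls T K) t) := by
  obtain ⟨g, g1, g2⟩ := G.chainTo hx (by omega)
  refine ⟨(g n).b, ?_, ?_⟩
  · have := G.centre (hp (g n).b)
    rwa [(g1 n hn).1] at this
  · rcases n with _ | n
    · omega
    · have h := g2 n (n+1) (by omega) hn
      have := le_gr (y := pUF (ballWalls T K) (g (n+1)).b) hx (g n) (g1 n (by omega)).2
        ((mem_pUF _).2 h.2.1)
      rwa [(g1 n (by omega)).1] at this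

theorem Geo.pUF_dual (G : Geo T K) (t : T) :
    pUF (ballWalls T K) t ∈ dualSpace (ballWalls T K) (disparateChains T K) := by
  refine ⟨isUF_pUF t, fun s => ?_⟩
  refine lt_of_le_of_lt (b := ((⌊(dist s t + 2 * K) / (8 * K)⌋₊ + 1 - 0 : ℕ) : ℕ∞)) ?_
    (ENat.coe_lt_top _)
  refine iSup₂_le ?_
  rintro c ⟨hc, hs⟩
  rcases c.eq_empty_or_nonempty with rfl | hne
  · simp
  obtain ⟨f, f1, f2⟩ := orient s hc _ _ (isUF_pUF t) (isUF_pUF s).2.1 hs hne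
  have hfx : ∀ h ∈ c, (f h).h ∈ pUF (ballWalls T K) t := by
    intro h hh
    rw [f2 h hh, mem_pUF]
    exact (f h).ho
  refine G.inj (isUF_pUF t) f f1 hfx _ _ ?_
  intro h hh
  refine ⟨Nat.zero_le _, Nat.lt_succ_of_le (Nat.le_floor ?_)⟩
  have hK := G.pos
  have h1 := G.dep_dist (f h)
  have h2 := G.cross _ _ (f h).hw t ((mem_pUF _).1 (hfx h hh)) s (f h).ho
  rw [le_div_iff₀ (by linarith)]
  rw [dist_comm _ s, dist_comm t s] at h2
  have := dist_nonneg (x := t) (y := (f h).b)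
  linarith

theorem Geo.dense (G : Geo T K) (o : T) (x : Set (Set T))
    (hx : x ∈ dualSpace (ballWalls T K) (disparateChains T K)) :
    ∃ t : T, dD (disparateChains T K) x (pUF (ballWalls T K) t) ≤ (11 : ℕ∞) := by
  have hp : ∀ t : T, Fin' K o (pUF (ballWalls T K) t) := fun t => G.fin_of o (G.pUF_dual t)
  have hx' := G.fin_of o hx
  by_cases h : 0 < gr K o x x
  · obtain ⟨t, h1, h2⟩ := G.interm hp hx' (n := gr K o x x - 1) (by omega)
    refine ⟨t, (G.dD_le hx' (hp t)).trans ?_⟩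
    have : (gr K o x x - (gr K o x (pUF (ballWalls T K) t) - 2)) +
      (gr K o (pUF (ballWalls T K) t) (pUF (ballWalls T K) t) -
        (gr K o x (pUF (ballWalls T K) t) - 2)) ≤ 11 := by omega
    exact_mod_cast this
  · refine ⟨o, (G.dD_le hx' (hp o)).trans ?_⟩
    have h0 : gr K o (pUF (ballWalls T K) o) (pUF (ballWalls T K) o) = 0 := by
      rcases gr_mem (hp o) (pUF (ballWalls T K) o) with h | ⟨w, -, h1, -⟩
      · exact h
      · exact absurd ((mem_pUF _).1 h1) w.ho
    have : (gr K o x x - (gr K o x (pUF (ballWalls T K) o) - 2)) +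
      (gr K o (pUF (ballWalls T K) o) (pUF (ballWalls T K) o) -
        (gr K o x (pUF (ballWalls T K) o) - 2)) ≤ 11 := by omega
    exact_mod_cast this

/-- The median statement. -/
theorem Geo.median (G : Geo T K) (c : ℝ) (μ : T → T → T → T)
    (hμ : IsCoarseMedian (fun a b : T => dist a b) μ c) :
    ∃ b : ℝ, ∀ t₁ t₂ t₃ : T,
        dDr (disparateChains T K)
          (medUF (pUF (ballWalls T K) t₁) (pUF (ballWalls T K) t₂)
            (pUF (ballWalls T K) t₃))
          (pUF (ballWalls T K) (μ t₁ t₂ t₃)) ≤ b := by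
  set M : ℕ := ⌊(c + 2 * K) / (8 * K)⌋₊ + 1 with hM
  refine ⟨((M + M + M : ℕ) : ℝ), ?_⟩
  intro t₁ t₂ t₃
  have hK := G.pos
  set m := μ t₁ t₂ t₃ with hm
  obtain ⟨q1, q2, q3⟩ := hμ t₁ t₂ t₃
  simp only [gp] at q1 q2 q3
  rw [← hm] at q1 q2 q3
  rw [dist_comm t₂ t₁] at q2
  rw [dist_comm t₃ t₁, dist_comm t₃ t₂] at q3
  have q1 := (abs_le.1 q1).2
  have q2 := (abs_le.1 q2).2
  have q3 := (abs_le.1 q3).2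
  have key : ∀ s t : T, dist s m + dist t m ≤ dist s t + 2 * c → ∀ w : OW T K m,
      s ∈ w.h → t ∈ w.h → 0 ≤ dep w ∧ dep w < M := by
    intro s t hst w hs ht
    refine ⟨Nat.zero_le _, Nat.lt_succ_of_le (Nat.le_floor ?_)⟩
    have h1 := G.dep_dist w
    have h2 := G.cross _ _ w.hw s hs m w.ho
    have h3 := G.cross _ _ w.hw t ht m w.ho
    have h4 := dist_triangle s w.b t
    rw [dist_comm w.b t] at h4
    rw [dist_comm w.b m] at h2 h3
    rw [le_div_iff₀ (by linarith)]
    linarith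
  have hle : dD (disparateChains T K)
      (medUF (pUF (ballWalls T K) t₁) (pUF (ballWalls T K) t₂) (pUF (ballWalls T K) t₃))
      (pUF (ballWalls T K) m) ≤ ((M + M + M : ℕ) : ℕ∞) := by
    refine iSup₂_le ?_
    rintro d ⟨hd, hs⟩
    rcases d.eq_empty_or_nonempty with rfl | hne
    · simp
    have hs' : Seps (pUF (ballWalls T K) m) (medUF (pUF (ballWalls T K) t₁)
        (pUF (ballWalls T K) t₂) (pUF (ballWalls T K) t₃)) d := by
      intro h hh
      have := hs h hh
      tauto
    have hmed : ∀ h ∈ ballWalls T K, (h ∈ medUF (pUF (ballWalls T K) t₁)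
        (pUF (ballWalls T K) t₂) (pUF (ballWalls T K) t₃) ↔ hᶜ ∉ medUF (pUF (ballWalls T K) t₁)
        (pUF (ballWalls T K) t₂) (pUF (ballWalls T K) t₃)) := by
      intro h hh
      have a1 := (isUF_pUF (K := K) t₁).2.1 h hh
      have a2 := (isUF_pUF (K := K) t₂).2.1 h hh
      have a3 := (isUF_pUF (K := K) t₃).2.1 h hh
      simp only [medUF, mem_union, mem_inter_iff]
      tauto
    obtain ⟨f, f1, f2⟩ := orient m hd _ _ (isUF_pUF m) hmed hs' hne
    · have hcu : d ⊆ ({h ∈ d | t₁ ∈ (f h).h ∧ t₂ ∈ (f h).h} ∪ {h ∈ d | t₁ ∈ (f h).h ∧ t₃ ∈ (f h).h})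
          ∪ {h ∈ d | t₂ ∈ (f h).h ∧ t₃ ∈ (f h).h} := by
        intro h hh
        have h1 := f2 h hh
        have h2 : (f h).h ∉ pUF (ballWalls T K) m := fun h3 => (f h).ho h3.2
        have h3 : (f h).h ∈ medUF (pUF (ballWalls T K) t₁)
          (pUF (ballWalls T K) t₂) (pUF (ballWalls T K) t₃) := by
          by_contra h4
          exact h2 (h1.2 h4)
        simp only [medUF, mem_union, mem_inter_iff, mem_pUF] at h3
        simp only [mem_union, mem_setOf_eq]
        tauto
      have b1 := G.inj (isUF_pUF t₁) (c := {h ∈ d | t₁ ∈ (f h).h ∧ t₂ ∈ (f h).h}) f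
        (fun h hh k hk => f1 h hh.1 k hk.1) (fun h hh => (mem_pUF _).2 hh.2.1) 0 M
        (fun h hh => key t₁ t₂ (by linarith) _ hh.2.1 hh.2.2)
      have b2 := G.inj (isUF_pUF t₁) (c := {h ∈ d | t₁ ∈ (f h).h ∧ t₃ ∈ (f h).h}) f
        (fun h hh k hk => f1 h hh.1 k hk.1) (fun h hh => (mem_pUF _).2 hh.2.1) 0 M
        (fun h hh => key t₁ t₃ (by linarith) _ hh.2.1 hh.2.2)
      have b3 := G.inj (isUF_pUF t₂) (c := {h ∈ d | t₂ ∈ (f h).h ∧ t₃ ∈ (f h).h}) f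
        (fun h hh k hk => f1 h hh.1 k hk.1) (fun h hh => (mem_pUF _).2 hh.2.1) 0 M
        (fun h hh => key t₂ t₃ (by linarith) _ hh.2.1 hh.2.2)
      calc d.encard ≤ _ := Set.encard_le_encard hcu
        _ ≤ _ := Set.encard_union_le _ _
        _ ≤ _ := add_le_add ((Set.encard_union_le _ _).trans (add_le_add b1 b2)) b3
        _ = _ := by push_cast; rfl
  unfold dDr
  have := ENat.toNat_le_of_le_coe hle
  exact_mod_cast this

end dual

section tree

/-- A discrete ultrametric-type Gromov product. -/
structure UM {X : Type u} (g : X → X → ℕ) : Prop where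
  symm : ∀ x y, g x y = g y x
  le : ∀ x y, g x y ≤ g x x
  um : ∀ x y z, min (g x y) (g y z) ≤ g x z

/-- Vertices of the tree of a discrete Gromov product. -/
def TV {X : Type u} (g : X → X → ℕ) : Type u :=
  {p : ℕ × Set X // ∃ x, p.1 ≤ g x x ∧ p.2 = {y | p.1 ≤ g x y}}

/-- The vertex at height `n` below `x`. -/
def tmk {X : Type u} (g : X → X → ℕ) (x : X) (n : ℕ) (h : n ≤ g x x) : TV g :=
  ⟨(n, {y | n ≤ g x y}), x, h, rfl⟩

/-- The tree of a discrete Gromov product. -/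
def TG {X : Type u} (g : X → X → ℕ) : SimpleGraph (TV g) where
  Adj v w := (v.1.1 + 1 = w.1.1 ∧ w.1.2 ⊆ v.1.2) ∨ (w.1.1 + 1 = v.1.1 ∧ v.1.2 ⊆ w.1.2)
  symm := ⟨fun _ _ h => h.symm⟩
  loopless := ⟨fun v h => by rcases h with h | h <;> omega⟩

variable {X : Type u} {g : X → X → ℕ}

theorem UM.mk_eq (U : UM g) {x y : X} {n : ℕ} (hx : n ≤ g x x) (hy : n ≤ g y y) (h : n ≤ g x y) :
    tmk g x n hx = tmk g y n hy := by
  unfold tmk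
  apply Subtype.ext
  simp only [Prod.mk.injEq, true_and]
  ext z
  have h1 := U.um x y z
  have h2 := U.um y x z
  have h3 := U.symm x y
  change n ≤ g x z ↔ n ≤ g y z
  omega

theorem TV.ex (v : TV g) : ∃ x h, v = tmk g x v.1.1 h := by
  obtain ⟨⟨n, S⟩, x, h, h'⟩ := v
  refine ⟨x, h, ?_⟩
  apply Subtype.ext
  simp only [tmk, Prod.mk.injEq, true_and]
  exact h'

theorem UM.eq_of_mem (U : UM g) (v : TV g) (x : X) (hx : x ∈ v.1.2) : ∃ h, v = tmk g x v.1.1 h := by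
  obtain ⟨y, hy, e⟩ := v.ex
  generalize v.1.1 = n at *
  subst e
  have hx : n ≤ g y x := hx
  have h1 := U.le x y
  have h2 := U.symm x y
  have h3 : n ≤ g x x := by omega
  exact ⟨h3, U.mk_eq _ _ hx⟩

theorem adj_mk (U : UM g) (x : X) (n : ℕ) (h : n + 1 ≤ g x x) :
    (TG g).Adj (tmk g x (n + 1) h) (tmk g x n (by omega)) := by
  right
  refine ⟨rfl, ?_⟩
  intro z hz
  have hz : n + 1 ≤ g x z := hz
  change n ≤ g x z
  omega

theorem UM.conn (U : UM g) [Nonempty X] : (TG g).Connected := by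
  have h0 : ∀ n x h, (TG g).Reachable (tmk g x n h) (tmk g x 0 (Nat.zero_le _)) := by
    intro n x
    induction n with
    | zero => intro h; exact SimpleGraph.Reachable.refl _
    | succ n ih => intro h; exact (adj_mk U x n h).reachable.trans (ih _)
  obtain ⟨x0⟩ := ‹Nonempty X›
  haveI : Nonempty (TV g) := ⟨tmk g x0 0 (Nat.zero_le _)⟩
  refine ⟨fun v w => ?_⟩
  obtain ⟨x, hx, e⟩ := v.ex
  obtain ⟨y, hy, e'⟩ := w.ex
  rw [e, e']
  refine (h0 _ _ _).trans ?_
  rw [U.mk_eq (y := y) (Nat.zero_le _) (Nat.zero_le _) (Nat.zero_le _)]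
  exact (h0 _ _ _).symm

theorem UM.dist_desc (U : UM g) [Nonempty X] (x : X) (k j : ℕ) (h : k + j ≤ g x x) :
    (TG g).dist (tmk g x (k + j) h) (tmk g x k (by omega)) ≤ j := by
  induction j with
  | zero => exact le_of_eq SimpleGraph.dist_self
  | succ j ih =>
    have h1 := U.conn.dist_triangle (u := tmk g x (k + (j + 1)) h) (v := tmk g x (k + j) (by omega))
      (w := tmk g x k (by omega))
    have h2 := SimpleGraph.dist_eq_one_iff_adj.2 (adj_mk U x (k + j) h)
    have h3 := ih (by omega)
    have h4 : (TG g).dist (tmk g x (k + (j + 1)) h) (tmk g x (k + j) (by omega)) = 1 := h2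
    omega

theorem UM.dist_desc2 (U : UM g) [Nonempty X] (x : X) (k n : ℕ) (h : n ≤ g x x) (hk : k ≤ n) :
    (TG g).dist (tmk g x n h) (tmk g x k (by omega)) + k ≤ n := by
  obtain ⟨j, rfl⟩ := Nat.exists_eq_add_of_le hk
  have := U.dist_desc x k j h
  omega

theorem UM.dist_le (U : UM g) [Nonempty X] (x y : X) (n m : ℕ) (h : n ≤ g x x) (h' : m ≤ g y y) :
    (TG g).dist (tmk g x n h) (tmk g y m h') + 2 * min (min n m) (g x y) ≤ n + m := by
  set k := min (min n m) (g x y) with hk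
  have h1 := U.dist_desc2 x k n h (by omega)
  have h2 := U.dist_desc2 y k m h' (by omega)
  rw [SimpleGraph.dist_comm] at h2
  have h3 := U.mk_eq (x := x) (y := y) (n := k) (by omega) (by omega) (by omega)
  rw [← h3] at h2
  have h4 := U.conn.dist_triangle (u := tmk g x n h) (v := tmk g x k (by omega))
      (w := tmk g y m h')
  omega

/-- The potential. -/
noncomputable def pot (y : X) (v : TV g) : ℤ :=
  v.1.1 + g y y - 2 * (min v.1.1 (g v.2.choose y) : ℕ)

theorem UM.pot_mk (U : UM g) (x y : X) (n : ℕ) (h : n ≤ g x x) :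
    pot y (tmk g x n h) = n + g y y - 2 * (min n (g x y) : ℕ) := by
  obtain ⟨h1, h2⟩ := (tmk g x n h).2.choose_spec
  set z := (tmk g x n h).2.choose with hz
  have h3 : z ∈ {y | (tmk g x n h).1.1 ≤ g z y} := h1
  rw [← h2] at h3
  have h3 : n ≤ g x z := h3
  have e : min n (g z y) = min n (g x y) := by
    have h4 := U.um x z y
    have h5 := U.um z x y
    have h6 := U.symm x z
    omega
  unfold pot
  rw [← hz]
  change (n : ℤ) + g y y - 2 * (min n (g z y) : ℕ) = _
  rw [e]

theorem UM.pot_lip1 (U : UM g) (y : X) (v w : TV g) (h : v.1.1 + 1 = w.1.1 ∧ w.1.2 ⊆ v.1.2) :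
    |pot y v - pot y w| ≤ 1 := by
  obtain ⟨h1, h2⟩ := h
  obtain ⟨x, hx, e⟩ := w.ex
  have hxw : x ∈ w.1.2 := by rw [e]; exact hx
  obtain ⟨hx', e'⟩ := U.eq_of_mem v x (h2 hxw)
  rw [e, e', U.pot_mk, U.pot_mk, abs_le]
  generalize w.1.1 = a at *
  generalize v.1.1 = b at *
  omega

theorem UM.pot_lip (U : UM g) (y : X) (v w : TV g) (p : (TG g).Walk v w) :
    |pot y v - pot y w| ≤ p.length := by
  induction p with
  | nil => simp
  | cons h p ih =>
    rename_i a b c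
    have : |pot y a - pot y b| ≤ 1 := by
      rcases h with h | h
      · exact U.pot_lip1 y _ _ h
      · rw [abs_sub_comm]; exact U.pot_lip1 y _ _ h
    have h2 := abs_sub_le (pot y a) (pot y b) (pot y c)
    simp only [SimpleGraph.Walk.length_cons]
    push_cast
    linarith

theorem UM.dist_eq (U : UM g) [Nonempty X] (x y : X) (n : ℕ) (h : n ≤ g x x) :
    (TG g).dist (tmk g x n h) (tmk g y (g y y) le_rfl) + 2 * min n (g x y) = n + g y y := by
  have h1 := U.dist_le x y n (g y y) h le_rfl
  obtain ⟨p, hp⟩ := U.conn.exists_walk_length_eq_dist (tmk g x n h) (tmk g y (g y y) le_rfl)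
  have h2 := U.pot_lip y _ _ p
  rw [hp, U.pot_mk, U.pot_mk] at h2
  have h3 := (le_abs_self _).trans h2
  have h4 := U.le y x
  have h5 := U.symm x y
  omega

theorem UM.bridge (U : UM g) (v w : TV g) (h : v.1.1 + 1 = w.1.1 ∧ w.1.2 ⊆ v.1.2) :
    (TG g).IsBridge s(w, v) := by
  rw [SimpleGraph.isBridge_iff]
  rintro ⟨p⟩
  have key : ∀ a b : TV g, ((TG g).deleteEdges {s(w, v)}).Walk a b →
      (w.1.1 ≤ a.1.1 ∧ a.1.2 ⊆ w.1.2) → (w.1.1 ≤ b.1.1 ∧ b.1.2 ⊆ w.1.2) := by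
    intro a b p
    induction p with
    | nil => exact id
    | cons hadj p ih =>
      rename_i a b c
      rintro ⟨h1, h2⟩
      apply ih
      rw [SimpleGraph.deleteEdges_adj] at hadj
      obtain ⟨had, hne⟩ := hadj
      rcases had with ⟨h3, h4⟩ | ⟨h3, h4⟩
      · exact ⟨by omega, h4.trans h2⟩
      · obtain ⟨x, hx, e⟩ := a.ex
        have hxa : x ∈ a.1.2 := by rw [e]; exact hx
        obtain ⟨hb, eb⟩ := U.eq_of_mem b x (h4 hxa)
        obtain ⟨hw, ew⟩ := U.eq_of_mem w x (h2 hxa)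
        obtain ⟨hv, ev⟩ := U.eq_of_mem v x (h.2 (h2 hxa))
        by_cases hl : w.1.1 = a.1.1
        · exfalso
          apply hne
          have e1 : w = a := by
            rw [ew, e]; simp only [hl]
          have e2 : v = b := by
            have : v.1.1 = b.1.1 := by omega
            rw [ev, eb]; simp only [this]
          rw [e1, e2]; rfl
        · refine ⟨by omega, ?_⟩
          rw [eb, ew]
          intro z hz
          have hz : b.1.1 ≤ g x z := hz
          change w.1.1 ≤ g x z
          omega
  have := key w v p ⟨le_rfl, subset_rfl⟩
  omega

theorem UM.isTree (U : UM g) [Nonempty X] : (TG g).IsTree := by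
  refine ⟨U.conn, ?_⟩
  rw [SimpleGraph.isAcyclic_iff_forall_adj_isBridge]
  intro v w h
  rcases h with h | h
  · rw [Sym2.eq_swap]; exact U.bridge _ _ h
  · exact U.bridge _ _ h

end tree

section hat

variable {X : Type u}

/-- Chain closure of a coarse Gromov product. -/
noncomputable def hat (r : X → X → ℕ) (a b : X) : ℕ :=
  sSup {n | Relation.TransGen (fun a b => n ≤ r a b) a b}

variable {r : X → X → ℕ}

theorem hat_bdd (chain : ∀ n a b, Relation.TransGen (fun a b => n ≤ r a b) a b → n ≤ r a b + 2)
    (a b : X) : BddAbove {n | Relation.TransGen (fun a b => n ≤ r a b) a b} :=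
  ⟨r a b + 2, fun n hn => chain n a b hn⟩

theorem hat_mem (chain : ∀ n a b, Relation.TransGen (fun a b => n ≤ r a b) a b → n ≤ r a b + 2)
    (a b : X) : Relation.TransGen (fun c d => hat r a b ≤ r c d) a b :=
  Nat.sSup_mem (s := {n | Relation.TransGen (fun a b => n ≤ r a b) a b})
    ⟨r a b, Relation.TransGen.single le_rfl⟩ (hat_bdd chain a b)

theorem le_hat (chain : ∀ n a b, Relation.TransGen (fun a b => n ≤ r a b) a b → n ≤ r a b + 2)
    {a b : X} {n : ℕ} (h : Relation.TransGen (fun c d => n ≤ r c d) a b) : n ≤ hat r a b :=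
  le_csSup (hat_bdd chain a b) h

theorem hat_self (le : ∀ x y, r x y ≤ r x x)
    (chain : ∀ n a b, Relation.TransGen (fun a b => n ≤ r a b) a b → n ≤ r a b + 2)
    (a : X) : hat r a a = r a a := by
  apply le_antisymm
  · rcases Relation.TransGen.head'_iff.1 (hat_mem chain a a) with ⟨c, hc, -⟩
    exact hc.trans (le _ _)
  · exact le_hat chain (Relation.TransGen.single le_rfl)

theorem hat_um (symm : ∀ x y, r x y = r y x) (le : ∀ x y, r x y ≤ r x x)
    (chain : ∀ n a b, Relation.TransGen (fun a b => n ≤ r a b) a b → n ≤ r a b + 2) :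
    UM (hat r) := by
  have hs : ∀ x y, hat r x y ≤ hat r y x := by
    intro x y
    apply le_hat chain
    have h := hat_mem chain x y
    generalize hat r x y = n at *
    induction h with
    | single h => exact Relation.TransGen.single (by rwa [symm])
    | tail h1 h2 ih => exact Relation.TransGen.head (by rwa [symm]) ih
  refine ⟨fun x y => le_antisymm (hs x y) (hs y x), ?_, ?_⟩
  · intro x y
    rw [hat_self le chain]
    rcases Relation.TransGen.head'_iff.1 (hat_mem chain x y) with ⟨c, hc, -⟩
    exact hc.trans (le _ _)
  · intro x y z
    apply le_hat chain
    refine Relation.TransGen.trans (Relation.TransGen.mono ?_ _ _ (hat_mem chain x y))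
      (Relation.TransGen.mono ?_ _ _ (hat_mem chain y z))
    · intro a b h
      exact (min_le_left _ _).trans h
    · intro a b h
      exact (min_le_right _ _).trans h

theorem walk_dist {V : Type u} {Γ : SimpleGraph V} (hc : Γ.Connected) {u v : V} (p : Γ.Walk u v)
    (hp : p.length = Γ.dist u v) (i j : ℕ) (hij : i ≤ j) (hj : j ≤ Γ.dist u v) :
    Γ.dist (p.getVert i) (p.getVert j) + i = j := by
  have key : ∀ i k, i + k ≤ p.length → Γ.dist (p.getVert i) (p.getVert (i + k)) ≤ k := by
    intro i k
    induction k with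
    | zero => intro _; exact le_of_eq SimpleGraph.dist_self
    | succ k ih =>
      intro hk
      have h1 := ih (by omega)
      have h2 := p.adj_getVert_succ (i := i + k) (by omega)
      have h2 := SimpleGraph.dist_eq_one_iff_adj.2 h2
      have h3 := hc.dist_triangle (u := p.getVert i) (v := p.getVert (i + k))
        (w := p.getVert (i + k + 1))
      have h4 : i + (k + 1) = i + k + 1 := rfl
      rw [h4]
      omega
  obtain ⟨k, rfl⟩ := Nat.exists_eq_add_of_le hij
  obtain ⟨l, hl⟩ := Nat.exists_eq_add_of_le hj
  have h1 := key 0 i (by omega)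
  have h2 := key i k (by omega)
  have h3 := key (i + k) l (by omega)
  rw [← hl, ← hp, p.getVert_length] at h3
  rw [zero_add, p.getVert_zero] at h1
  have h4 := hc.dist_triangle (u := u) (v := p.getVert i) (w := p.getVert (i + k))
  have h5 := hc.dist_triangle (u := u) (v := p.getVert (i + k)) (w := v)
  omega

theorem rg_of {V : Type u} {Γ : SimpleGraph V} (hc : Γ.Connected) (d : X → X → ℝ) (f : X → V)
    (hd : ∀ x y, |d x y - Γ.dist (f x) (f y)| ≤ 8) (hs : ∀ v, ∃ x, Γ.dist v (f x) ≤ 2) :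
    RGSpace d 14 := by
  classical
  intro x y
  choose s hs using hs
  obtain ⟨p, hp⟩ := hc.exists_walk_length_eq_dist (f x) (f y)
  set N := Γ.dist (f x) (f y) with hN
  set γ : ℝ → X := fun τ => if τ ≤ 0 then x else if (N : ℝ) + 1 ≤ τ then y else
    s (p.getVert ⌊τ⌋₊) with hγ
  have hN0 : (0 : ℝ) ≤ N := Nat.cast_nonneg _
  have key : ∀ τ ∈ Icc (0 : ℝ) (N + 1), ∃ i : ℕ, i ≤ N ∧ |τ - i| ≤ 1 ∧
      Γ.dist (p.getVert i) (f (γ τ)) ≤ 2 := by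
    rintro τ ⟨h1, h2⟩
    by_cases h3 : τ ≤ 0
    · refine ⟨0, Nat.zero_le _, ?_, ?_⟩
      · rw [abs_le]; push_cast; constructor <;> linarith
      · simp only [hγ, if_pos h3, p.getVert_zero, SimpleGraph.dist_self]; omega
    by_cases h4 : (N : ℝ) + 1 ≤ τ
    · refine ⟨N, le_rfl, ?_, ?_⟩
      · rw [abs_le]; constructor <;> linarith
      · simp only [hγ, if_neg h3, if_pos h4]
        rw [← hp, p.getVert_length, SimpleGraph.dist_self]; omega
    · refine ⟨⌊τ⌋₊, ?_, ?_, ?_⟩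
      · have : ⌊τ⌋₊ < N + 1 := (Nat.floor_lt h1).2 (by push_cast; linarith)
        omega
      · have a1 := Nat.floor_le h1
        have a2 := Nat.lt_floor_add_one τ
        rw [abs_le]; constructor <;> linarith
      · simp only [hγ, if_neg h3, if_neg h4]
        exact hs _
  refine ⟨γ, 0, N + 1, by linarith, ?_, ?_, ?_⟩
  · simp [hγ]
  · simp only [hγ]
    rw [if_neg (by linarith), if_pos le_rfl]
  · intro a ha b hb
    obtain ⟨i, i1, i2, i3⟩ := key a ha
    obtain ⟨j, j1, j2, j3⟩ := key b hb
    have h1 : abs ((Γ.dist (p.getVert i) (p.getVert j) : ℝ) - |a - b|) ≤ 2 := by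
      have e : (Γ.dist (p.getVert i) (p.getVert j) : ℝ) = |(i : ℝ) - j| := by
        rcases le_total i j with h | h
        · have h0 := walk_dist hc p hp i j h j1
          have h0 : (Γ.dist (p.getVert i) (p.getVert j) : ℝ) + i = j := by exact_mod_cast h0
          have h' : (i : ℝ) ≤ j := by exact_mod_cast h
          rw [abs_of_nonpos (by linarith)]
          linarith
        · have h0 := walk_dist hc p hp j i h i1
          have h0 : (Γ.dist (p.getVert j) (p.getVert i) : ℝ) + j = i := by exact_mod_cast h0
          have h' : (j : ℝ) ≤ i := by exact_mod_cast h
          rw [SimpleGraph.dist_comm, abs_of_nonneg (by linarith)]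
          linarith
      rw [e]
      refine (abs_abs_sub_abs_le _ _).trans ?_
      have : (i : ℝ) - j - (a - b) = (b - j) - (a - i) := by ring
      rw [this]
      refine (abs_sub _ _).trans ?_
      linarith
    have h2 := hd (γ a) (γ b)
    have t1 := hc.dist_triangle (u := f (γ a)) (v := p.getVert i) (w := f (γ b))
    have t2 := hc.dist_triangle (u := p.getVert i) (v := p.getVert j) (w := f (γ b))
    have t3 := hc.dist_triangle (u := p.getVert i) (v := f (γ a)) (w := p.getVert j)
    have t4 := hc.dist_triangle (u := f (γ a)) (v := f (γ b)) (w := p.getVert j)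
    rw [SimpleGraph.dist_comm (u := f (γ a)) (v := p.getVert i)] at t1
    rw [SimpleGraph.dist_comm (u := f (γ b)) (v := p.getVert j)] at t4
    have u1 : (Γ.dist (f (γ a)) (f (γ b)) : ℝ) ≤ Γ.dist (p.getVert i) (p.getVert j) + 4 := by
      exact_mod_cast (by omega)
    have u2 : (Γ.dist (p.getVert i) (p.getVert j) : ℝ) ≤ Γ.dist (f (γ a)) (f (γ b)) + 4 := by
      exact_mod_cast (by omega)
    rw [abs_le] at h1 h2 ⊢
    constructor <;> linarith [h1.1, h1.2, h2.1, h2.2]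

theorem qt_of [Nonempty X] (d : X → X → ℝ) (d0 : ∀ x y, 0 ≤ d x y)
    (symm : ∀ x y, r x y = r y x) (le : ∀ x y, r x y ≤ r x x)
    (chain : ∀ n a b, Relation.TransGen (fun a b => n ≤ r a b) a b → n ≤ r a b + 2)
    (d1 : ∀ x y, d x y + 2 * r x y ≤ r x x + r y y + 4)
    (d2 : ∀ x y, (r x x : ℝ) + r y y ≤ d x y + 2 * r x y + 2)
    (hint : ∀ x n, n < r x x → ∃ t, r t t ≤ n + 2 ∧ n ≤ r x t) : IsQuasitree d 14 := by
  have U := hat_um symm le chain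
  have hself := hat_self le chain
  have hlo : ∀ x y, r x y ≤ hat r x y := fun x y =>
    le_hat chain (Relation.TransGen.single le_rfl)
  have hhi : ∀ x y, hat r x y ≤ r x y + 2 := fun x y => chain _ _ _ (hat_mem chain x y)
  set f : X → TV (hat r) := fun x => tmk (hat r) x (hat r x x) le_rfl with hf
  have hdist : ∀ x y, |d x y - (TG (hat r)).dist (f x) (f y)| ≤ 8 := by
    intro x y
    have h1 := U.dist_eq x y (hat r x x) le_rfl
    rw [min_eq_right (U.le x y)] at h1
    have h0 : (TG (hat r)).dist (f x) (f y) + 2 * hat r x y = r x x + r y y := by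
      have e1 := hself x
      have e2 := hself y
      have h1 : (TG (hat r)).dist (f x) (f y) + 2 * hat r x y = hat r x x + hat r y y := h1
      omega
    have h1 : ((TG (hat r)).dist (f x) (f y) : ℝ) + 2 * hat r x y = r x x + r y y := by
      exact_mod_cast h0
    have h2 : (r x y : ℝ) ≤ hat r x y := by exact_mod_cast hlo x y
    have h3 : (hat r x y : ℝ) ≤ r x y + 2 := by exact_mod_cast hhi x y
    have h4 := d1 x y
    have h5 := d2 x y
    rw [abs_le]
    constructor <;> linarith
  have hsurj : ∀ v, ∃ x, (TG (hat r)).dist v (f x) ≤ 2 := by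
    intro v
    obtain ⟨x, hx, e⟩ := v.ex
    generalize v.1.1 = n at *
    subst e
    rcases hx.lt_or_eq with h | h
    · rw [hself] at h
      obtain ⟨t, t1, t2⟩ := hint x n h
      refine ⟨t, ?_⟩
      have h1 := U.dist_eq x t n hx
      have h2 := hlo x t
      have h3 := hself t
      have h4 : (TG (hat r)).dist (tmk (hat r) x n hx) (f t) + 2 * min n (hat r x t) =
        n + hat r t t := h1
      omega
    · subst h
      refine ⟨x, ?_⟩
      simp only [hf, SimpleGraph.dist_self]
      omega
  refine ⟨rg_of U.conn d f hdist hsurj, TV (hat r), TG (hat r), U.isTree, f, ?_, ?_⟩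
  · intro x y
    have h1 := abs_le.1 (hdist x y)
    have h2 := d0 x y
    have h3 : (0 : ℝ) ≤ (TG (hat r)).dist (f x) (f y) := Nat.cast_nonneg _
    constructor
    · have : d x y / 14 ≤ d x y := by linarith
      simp only
      linarith [h1.1, h1.2]
    · simp only
      linarith [h1.1, h1.2]
  · intro v
    obtain ⟨x, hx⟩ := hsurj v
    refine ⟨x, ?_⟩
    have : ((TG (hat r)).dist v (f x) : ℝ) ≤ 2 := by exact_mod_cast hx
    linarith

end hat

section isom

variable {T : Type u} [MetricSpace T] {K : ℝ}

theorem wall_image (e : T ≃ᵢ T) {t : T} {h : Set T} (hw : wallFromBall T K t h) :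
    wallFromBall T K (e t) (e '' h) := by
  obtain ⟨Ct, ⟨p, hp, rfl⟩, hh⟩ := hw
  have hB : e '' (closedBall t K) = closedBall (e t) K := e.image_closedBall t K
  have hc : ∀ s : Set T, e '' sᶜ = (e '' s)ᶜ := fun s => image_compl_eq e.bijective
  have hC : e '' (connectedComponentIn (closedBall t K)ᶜ p) =
      connectedComponentIn (closedBall (e t) K)ᶜ (e p) := by
    have := e.toHomeomorph.image_connectedComponentIn hp
    have h2 : (e.toHomeomorph : T → T) = e := rfl
    rw [h2, hc, hB] at this
    exact this
  refine ⟨_, ⟨e p, ?_, rfl⟩, ?_⟩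
  · rw [← hB, ← hc]; exact mem_image_of_mem _ hp
  · rw [← hC, ← hB, ← hc, ← image_union, ← hc]
    rcases hh with rfl | rfl | rfl | rfl <;> simp

theorem img_symm (e : T ≃ᵢ T) (h : Set T) : e.symm '' (e '' h) = h := by
  simp [image_image]

theorem img_symm' (e : T ≃ᵢ T) (h : Set T) : e '' (e.symm '' h) = h := by
  simp [image_image]

theorem img_inj (e : T ≃ᵢ T) {h k : Set T} : e '' h = e '' k ↔ h = k :=
  image_injective.2 e.injective |>.eq_iff

/-- The induced map on ultrafilters. -/
def eMap (e : T ≃ᵢ T) (x : Set (Set T)) : Set (Set T) := (fun h => e '' h) '' x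

theorem mem_eMap (e : T ≃ᵢ T) (x : Set (Set T)) (h : Set T) : h ∈ eMap e x ↔ e.symm '' h ∈ x := by
  constructor
  · rintro ⟨k, hk, rfl⟩
    simpa only [img_symm] using hk
  · intro hh
    exact ⟨_, hh, img_symm' e h⟩

theorem img_mem_eMap (e : T ≃ᵢ T) (x : Set (Set T)) (h : Set T) : e '' h ∈ eMap e x ↔ h ∈ x := by
  rw [mem_eMap, img_symm]

theorem eMap_symm (e : T ≃ᵢ T) (x : Set (Set T)) : eMap e.symm (eMap e x) = x := by
  ext h
  rw [mem_eMap, mem_eMap, IsometryEquiv.symm_symm, img_symm]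

theorem eMap_symm' (e : T ≃ᵢ T) (x : Set (Set T)) : eMap e (eMap e.symm x) = x := by
  ext h
  rw [mem_eMap, mem_eMap, IsometryEquiv.symm_symm, img_symm']

theorem ballWalls_img (e : T ≃ᵢ T) {h : Set T} (hh : h ∈ ballWalls T K) :
    e '' h ∈ ballWalls T K := by
  obtain ⟨t, ht⟩ := hh
  exact ⟨e t, wall_image e ht⟩

theorem chain_img (e : T ≃ᵢ T) {c : Set (Set T)} (hc : c ∈ disparateChains T K) :
    eMap e c ∈ disparateChains T K := by
  obtain ⟨⟨σ, s1, s2⟩, β, b1, b2⟩ := hc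
  have hcc : ∀ s : Set T, e '' sᶜ = (e '' s)ᶜ := fun s => image_compl_eq e.bijective
  have hss : ∀ s t : Set T, s ⊂ t → e '' s ⊂ e '' t := fun s t h =>
    e.injective.image_strictMono h
  refine ⟨⟨fun h => e '' σ (e.symm '' h), ?_, ?_⟩, fun h => e (β (e.symm '' h)), ?_, ?_⟩
  · rintro _ ⟨h, hh, rfl⟩
    simp only [img_symm]
    rcases s1 h hh with h1 | h1
    · left; rw [h1]
    · right; rw [h1, hcc]
  · rintro _ ⟨h, hh, rfl⟩ _ ⟨k, hk, rfl⟩ hne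
    simp only [img_symm]
    have : h ≠ k := fun h' => hne (by rw [h'])
    exact (s2 h hh k hk this).imp (hss _ _) (hss _ _)
  · rintro _ ⟨h, hh, rfl⟩
    simp only [img_symm]
    exact wall_image e (b1 h hh)
  · rintro _ ⟨h, hh, rfl⟩ _ ⟨k, hk, rfl⟩ hne
    simp only [img_symm, e.dist_eq]
    have : h ≠ k := fun h' => hne (by rw [h'])
    exact b2 h hh k hk this

theorem dD_eMap_le (e : T ≃ᵢ T) (x y : Set (Set T)) :
    dD (disparateChains T K) x y ≤ dD (disparateChains T K) (eMap e x) (eMap e y) := by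
  refine iSup₂_le ?_
  rintro c ⟨hc, hs⟩
  have h1 : (eMap e c).encard = c.encard :=
    (image_injective.2 e.injective).encard_image c
  rw [← h1]
  refine le_iSup₂_of_le (eMap e c) ⟨chain_img e hc, ?_⟩ le_rfl
  rintro _ ⟨h, hh, rfl⟩
  simp only [img_mem_eMap]
  exact hs h hh

theorem dD_eMap (e : T ≃ᵢ T) (x y : Set (Set T)) :
    dD (disparateChains T K) (eMap e x) (eMap e y) = dD (disparateChains T K) x y := by
  apply le_antisymm
  · have := dD_eMap_le (K := K) e.symm (eMap e x) (eMap e y)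
    rwa [eMap_symm, eMap_symm] at this
  · exact dD_eMap_le e x y

theorem pUF_eMap (e : T ≃ᵢ T) (t : T) :
    eMap e (pUF (ballWalls T K) t) = pUF (ballWalls T K) (e t) := by
  ext h
  rw [mem_eMap]
  constructor
  · rintro ⟨h1, h2⟩
    have h3 := ballWalls_img e h1
    rw [img_symm'] at h3
    refine ⟨h3, ?_⟩
    have := mem_image_of_mem e h2
    rwa [img_symm'] at this
  · rintro ⟨h1, h2⟩
    refine ⟨ballWalls_img _ h1, e t, h2, ?_⟩
    simp

theorem dual_eMap (e : T ≃ᵢ T) {x : Set (Set T)}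
    (hx : x ∈ dualSpace (ballWalls T K) (disparateChains T K)) :
    eMap e x ∈ dualSpace (ballWalls T K) (disparateChains T K) := by
  obtain ⟨⟨u1, u2, u3⟩, hd⟩ := hx
  have hcc : ∀ s : Set T, e.symm '' sᶜ = (e.symm '' s)ᶜ := fun s => image_compl_eq e.symm.bijective
  refine ⟨⟨?_, ?_, ?_⟩, ?_⟩
  · rintro _ ⟨h, hh, rfl⟩
    exact ballWalls_img e (u1 hh)
  · intro h hh
    rw [mem_eMap, mem_eMap, hcc]
    exact u2 _ (ballWalls_img e.symm hh)
  · intro h hh k hk hsub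
    rw [mem_eMap] at hh ⊢
    exact u3 _ hh _ (ballWalls_img e.symm hk) (image_mono hsub)
  · intro s
    have := hd (e.symm s)
    rwa [← dD_eMap e, pUF_eMap, e.apply_symm_apply] at this

theorem isom_claim (e : T ≃ᵢ T) : ∃ eD : Set (Set T) → Set (Set T),
      Set.BijOn eD (dualSpace (ballWalls T K) (disparateChains T K))
        (dualSpace (ballWalls T K) (disparateChains T K)) ∧
      (∀ x ∈ dualSpace (ballWalls T K) (disparateChains T K),
        ∀ y ∈ dualSpace (ballWalls T K) (disparateChains T K),
          dD (disparateChains T K) (eD x) (eD y) = dD (disparateChains T K) x y) ∧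
      ∀ t : T, eD (pUF (ballWalls T K) t) = pUF (ballWalls T K) (e t) := by
  refine ⟨eMap e, ⟨fun x hx => dual_eMap e hx, ?_, ?_⟩, fun x _ y _ => dD_eMap e x y, pUF_eMap e⟩
  · intro x _ y _ h
    have := congrArg (eMap e.symm) h
    rwa [eMap_symm, eMap_symm] at this
  · intro x hx
    exact ⟨_, dual_eMap e.symm hx, eMap_symm' e x⟩

end isom

theorem Geo.quasitree {T : Type u} [MetricSpace T] {K : ℝ} (G : Geo T K) (o : T) :
    IsQuasitree
        (fun x y : dualSpace (ballWalls T K) (disparateChains T K) =>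
          dDr (disparateChains T K) x.1 y.1) 14 := by
  have hF : ∀ x : dualSpace (ballWalls T K) (disparateChains T K), Fin' K o x.1 :=
    fun x => G.fin_of o x.2
  have hp : ∀ t : T, Fin' K o (pUF (ballWalls T K) t) := fun t => G.fin_of o (G.pUF_dual t)
  haveI : Nonempty (dualSpace (ballWalls T K) (disparateChains T K)) := ⟨⟨_, G.pUF_dual o⟩⟩
  refine qt_of (r := fun x y => gr K o x.1 y.1) _ (fun x y => Nat.cast_nonneg _)
    (fun x y => gr_symm _ _) (fun x y => gr_le (hF x) _) ?_ ?_ ?_ ?_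
  · intro n a b h
    exact G.chain_hyp (fun x : dualSpace (ballWalls T K) (disparateChains T K) => x.1) hF h
  · intro x y
    have h1 := G.dD_le (hF x) (hF y)
    have h2 := ENat.toNat_le_of_le_natCast h1
    have h3 : (dD (disparateChains T K) x.1 y.1).toNat + 2 * gr K o x.1 y.1 ≤
        gr K o x.1 x.1 + gr K o y.1 y.1 + 4 := by
      have a := gr_le (hF x) y.1
      have b := gr_le (hF y) x.1
      rw [gr_symm] at b
      omega
    unfold dDr
    exact_mod_cast h3
  · intro x y
    have h1 := G.dD_le (hF x) (hF y)
    have hne : dD (disparateChains T K) x.1 y.1 ≠ ⊤ := ne_top_of_le_ne_top (ENat.natCast_ne_top _) h1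
    have h2 := G.le_dD (hF x) (hF y)
    rw [← ENat.natCast_toNat hne, Nat.cast_le] at h2
    have h3 : gr K o x.1 x.1 + gr K o y.1 y.1 ≤
        (dD (disparateChains T K) x.1 y.1).toNat + 2 * gr K o x.1 y.1 + 2 := by
      omega
    unfold dDr
    exact_mod_cast h3
  · intro x n hn
    obtain ⟨t, t1, t2⟩ := G.interm hp (hF x) hn
    exact ⟨⟨_, G.pUF_dual t⟩, t1, t2⟩

/-- Lemma 3.2.  With `T` a geodesic `δ`-hyperbolic quasitree, `W` its
walls from `K`-balls (`K > 100δ`, every `K`-ball disconnects `T`) and `D` the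
disparate-chain dualisable system: `(T,d_D)` (i.e. the set of principal ultrafilters)
is `11`-coarsely dense in the dual space `T_D`; in particular `T_D` is a quasitree and
the inclusion `T → T_D` is quasimedian (with respect to any coarse median on `T` and
the majority-vote median on `T_D`).  Moreover, any group acting by isometries on
`(T,d)` acts by isometries on `T_D`: every isometry of `T` induces a `d_D`-preserving
bijection of `T_D` compatible with the inclusion. -/
theorem quasitree_dense_in_dual {T : Type u} [MetricSpace T]
    (δ lam K : ℝ) (hδ : 0 ≤ δ)
    (hqt : IsQuasitree (fun a b : T => dist a b) lam)
    (hgeo : RGSpace (fun a b : T => dist a b) 0)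
    (hhyp : IsHyp (fun a b : T => dist a b) δ)
    (hK : 100 * δ < K)
    (hdisc : ∀ t : T, ¬ IsPreconnected (closedBall t K)ᶜ) :
    (∀ t : T, pUF (ballWalls T K) t ∈ dualSpace (ballWalls T K) (disparateChains T K)) ∧
    (∀ x ∈ dualSpace (ballWalls T K) (disparateChains T K),
      ∃ t : T, dD (disparateChains T K) x (pUF (ballWalls T K) t) ≤ (11 : ℕ∞)) ∧
    (∃ lam' : ℝ,
      IsQuasitree
        (fun x y : dualSpace (ballWalls T K) (disparateChains T K) =>
          dDr (disparateChains T K) x.1 y.1) lam') ∧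
    (∀ (c : ℝ) (μ : T → T → T → T), IsCoarseMedian (fun a b : T => dist a b) μ c →
      ∃ b : ℝ, ∀ t₁ t₂ t₃ : T,
        dDr (disparateChains T K)
          (medUF (pUF (ballWalls T K) t₁) (pUF (ballWalls T K) t₂)
            (pUF (ballWalls T K) t₃))
          (pUF (ballWalls T K) (μ t₁ t₂ t₃)) ≤ b) ∧
    (∀ e : T ≃ᵢ T, ∃ eD : Set (Set T) → Set (Set T),
      Set.BijOn eD (dualSpace (ballWalls T K) (disparateChains T K))
        (dualSpace (ballWalls T K) (disparateChains T K)) ∧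
      (∀ x ∈ dualSpace (ballWalls T K) (disparateChains T K),
        ∀ y ∈ dualSpace (ballWalls T K) (disparateChains T K),
          dD (disparateChains T K) (eD x) (eD y) = dD (disparateChains T K) x y) ∧
      ∀ t : T, eD (pUF (ballWalls T K) t) = pUF (ballWalls T K) (e t)) := by
  obtain ⟨o⟩ : Nonempty T := by
    obtain ⟨-, V, Γ, hΓ, f, -, hs⟩ := hqt
    obtain ⟨v⟩ := hΓ.connected.nonempty
    obtain ⟨t, -⟩ := hs v
    exact ⟨t⟩
  have hK0 : 0 < K := by linarith
  have G : Geo T K := geo_of hK0 hgeo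
  exact ⟨G.pUF_dual, G.dense o, ⟨14, G.quasitree o⟩, G.median, fun e => isom_claim e⟩

end GSC
end
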